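/- arXiv:1311.5046 — 4 statements merged into one kernel-verified Lean document; each statement's English description precedes it below -/
import Mathlib

section
/- Let G be a bridgeless bipartite graph that is not 2-simultaneous edge colorable, such that every bridgeless bipartite graph with fewer edges than G is 2-simultaneous edge colorable, and every bridgeless bipartite graph with the same number of edges as G and more vertices than G is 2-simultaneous edge colorable. Then for each vertex v of G of degree 2: (a) the graph G − v is bridgeless, and (b) if N(v) = {u, w}, then N(u) ∩ N(w) = {v}. -/
open SimpleGraph

/-- A proper edge coloring of `G`: incident distinct edges receive different colors. -/
def IsProperEdgeColoring {V : Type*} (G : SimpleGraph V) (c : Sym2 V → ℕ) : Prop :=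
  ∀ e₁ ∈ G.edgeSet, ∀ e₂ ∈ G.edgeSet, e₁ ≠ e₂ → (∃ v, v ∈ e₁ ∧ v ∈ e₂) → c e₁ ≠ c e₂

/-- The set of colors appearing on the edges of `G` incident to the vertex `v`. -/
def colorsAt {V : Type*} (G : SimpleGraph V) (c : Sym2 V → ℕ) (v : V) : Set ℕ :=
  {k | ∃ e ∈ G.edgeSet, v ∈ e ∧ c e = k}

/-- A `μ`-simultaneous edge coloring of `G`: `μ` proper edge colorings such that at every
vertex the set of colors appearing on its incident edges is the same in all colorings, and
no edge gets the same color in two different colorings. -/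
def IsSimultaneousEdgeColoring {V : Type*} (G : SimpleGraph V) (μ : ℕ)
    (c : Fin μ → Sym2 V → ℕ) : Prop :=
  (∀ i, IsProperEdgeColoring G (c i)) ∧
  (∀ i j : Fin μ, ∀ v : V, colorsAt G (c i) v = colorsAt G (c j) v) ∧
  (∀ i j : Fin μ, i ≠ j → ∀ e ∈ G.edgeSet, c i e ≠ c j e)

/-- `G` admits a `μ`-simultaneous edge coloring. -/
def SimultaneousEdgeColorable {V : Type*} (G : SimpleGraph V) (μ : ℕ) : Prop :=
  ∃ c : Fin μ → Sym2 V → ℕ, IsSimultaneousEdgeColoring G μ c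
/-- The edge cut determined by a vertex set `S`: all edges with one endpoint in `S`
and the other in its complement. -/
def cutEdges {V : Type*} (G : SimpleGraph V) (S : Set V) : Set (Sym2 V) :=
  {e | e ∈ G.edgeSet ∧ ∃ a ∈ S, ∃ b ∈ Sᶜ, e = s(a, b)}

/-- `G` is `k`-edge-connected: it is connected and every edge cut has at least `k` edges. -/
def IsKEdgeConnected {V : Type*} (G : SimpleGraph V) (k : ℕ) : Prop :=
  G.Connected ∧ ∀ S : Set V, S.Nonempty → Sᶜ.Nonempty → k ≤ (cutEdges G S).ncard

/-- Two distinct edges of `G` leave the vertex set `S`. -/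
def TwoCross {V : Type*} (G : SimpleGraph V) (S : Set V) : Prop :=
  ∃ a b a' b', a ∈ S ∧ b ∉ S ∧ G.Adj a b ∧ a' ∈ S ∧ b' ∉ S ∧ G.Adj a' b' ∧ (a ≠ a' ∨ b ≠ b')

theorem two_le_ncard_cutEdges_iff {V : Type*} [Finite V] (G : SimpleGraph V) (S : Set V) :
    2 ≤ (cutEdges G S).ncard ↔ TwoCross G S := by
  have h : 2 ≤ (cutEdges G S).ncard ↔ 1 < (cutEdges G S).ncard := Iff.rfl
  rw [h, Set.one_lt_ncard (Set.toFinite _)]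
  constructor
  · rintro ⟨e, ⟨he, a, ha, b, hb, rfl⟩, e', ⟨he', a', ha', b', hb', rfl⟩, hne⟩
    refine ⟨a, b, a', b', ha, hb, he, ha', hb', he', ?_⟩
    by_contra! h
    exact hne (by rw [h.1, h.2])
  · rintro ⟨a, b, a', b', ha, hb, he, ha', hb', he', hne⟩
    refine ⟨s(a, b), ⟨he, a, ha, b, hb, rfl⟩, s(a', b'), ⟨he', a', ha', b', hb', rfl⟩, ?_⟩
    intro h
    rcases Sym2.eq_iff.1 h with ⟨h1, h2⟩ | ⟨h1, h2⟩
    · simp_all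
    · exact hb' (h1 ▸ ha)

theorem isKEdgeConnected_two_iff {V : Type*} [Finite V] (G : SimpleGraph V) :
    IsKEdgeConnected G 2 ↔
      Nonempty V ∧ ∀ S : Set V, S.Nonempty → Sᶜ.Nonempty → TwoCross G S := by
  simp only [IsKEdgeConnected, two_le_ncard_cutEdges_iff]
  constructor
  · rintro ⟨h, h'⟩
    exact ⟨h.nonempty, h'⟩
  · rintro ⟨hV, h⟩
    refine ⟨⟨fun x y => ?_⟩, h⟩
    by_contra hxy
    obtain ⟨a, b, -, -, ha, hb, hab, -⟩ := h {w | G.Reachable x w} ⟨x, Reachable.refl x⟩ ⟨y, hxy⟩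
    exact hb (Reachable.trans ha hab.reachable)

/-- A `2`-simultaneous edge coloring, as two symmetric functions on pairs of vertices. -/
structure SEPair {V : Type*} (G : SimpleGraph V) (c d : V → V → ℕ) : Prop where
  symm_left : ∀ x y, c x y = c y x
  symm_right : ∀ x y, d x y = d y x
  inj_left : ∀ v x y, G.Adj v x → G.Adj v y → c v x = c v y → x = y
  inj_right : ∀ v x y, G.Adj v x → G.Adj v y → d v x = d v y → x = y
  exists_right : ∀ v x, G.Adj v x → ∃ y, G.Adj v y ∧ d v y = c v x
  exists_left : ∀ v x, G.Adj v x → ∃ y, G.Adj v y ∧ c v y = d v x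
  ne : ∀ v x, G.Adj v x → c v x ≠ d v x

theorem SEPair.swap {V : Type*} {G : SimpleGraph V} {c d : V → V → ℕ} (h : SEPair G c d) :
    SEPair G d c :=
  ⟨h.2, h.1, h.4, h.3, h.6, h.5, fun v x hx => (h.7 v x hx).symm⟩

theorem isProperEdgeColoring_iff {V : Type*} (G : SimpleGraph V) (c : Sym2 V → ℕ) :
    IsProperEdgeColoring G c ↔
      ∀ v x y, G.Adj v x → G.Adj v y → c s(v, x) = c s(v, y) → x = y := by
  constructor
  · intro h v x y hx hy hc
    by_contra hxy
    refine h s(v, x) hx s(v, y) hy ?_ ⟨v, by simp, by simp⟩ hc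
    exact fun e => hxy (Sym2.congr_right.1 e)
  · rintro h e₁ h₁ e₂ h₂ hne ⟨v, hv₁, hv₂⟩ hc
    obtain ⟨x, rfl⟩ := hv₁
    obtain ⟨y, rfl⟩ := hv₂
    exact hne (by rw [h v x y h₁ h₂ hc])

theorem mem_colorsAt_iff {V : Type*} (G : SimpleGraph V) (c : Sym2 V → ℕ) (v : V) (k : ℕ) :
    k ∈ colorsAt G c v ↔ ∃ x, G.Adj v x ∧ c s(v, x) = k := by
  constructor
  · rintro ⟨e, he, hv, hk⟩
    obtain ⟨x, rfl⟩ := hv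
    exact ⟨x, he, hk⟩
  · rintro ⟨x, hx, hk⟩
    exact ⟨s(v, x), hx, by simp, hk⟩

theorem simultaneousEdgeColorable_two_iff {V : Type*} (G : SimpleGraph V) :
    SimultaneousEdgeColorable G 2 ↔ ∃ c d, SEPair G c d := by
  constructor
  · rintro ⟨c, h1, h2, h3⟩
    simp only [isProperEdgeColoring_iff] at h1
    simp only [Set.ext_iff, mem_colorsAt_iff] at h2
    refine ⟨fun x y => c 0 s(x, y), fun x y => c 1 s(x, y), ?_, ?_, h1 0, h1 1, ?_, ?_, ?_⟩
    · intro x y; simp only [Sym2.eq_swap]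
    · intro x y; simp only [Sym2.eq_swap]
    · intro v x hx
      exact (h2 0 1 v _).1 ⟨x, hx, rfl⟩
    · intro v x hx
      exact (h2 0 1 v _).2 ⟨x, hx, rfl⟩
    · intro v x hx
      exact h3 0 1 (by decide) _ hx
  · rintro ⟨c, d, h⟩
    refine ⟨![Sym2.lift ⟨c, h.symm_left⟩, Sym2.lift ⟨d, h.symm_right⟩], ?_, ?_, ?_⟩
    · simp only [isProperEdgeColoring_iff, Fin.forall_fin_two]
      exact ⟨h.inj_left, h.inj_right⟩
    · simp only [Set.ext_iff, mem_colorsAt_iff]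
      have key : ∀ v k, (∃ x, G.Adj v x ∧ c v x = k) ↔ (∃ x, G.Adj v x ∧ d v x = k) := by
        intro v k
        constructor
        · rintro ⟨x, hx, rfl⟩; exact h.exists_right v x hx
        · rintro ⟨x, hx, rfl⟩; exact h.exists_left v x hx
      simp only [Fin.forall_fin_two]
      refine ⟨⟨?_, key⟩, fun v k => (key v k).symm, ?_⟩ <;> exact fun _ _ => by trivial
    · intro i j hij e
      induction e with | h x y => ?_
      revert i j
      simp only [Fin.forall_fin_two]
      refine ⟨⟨fun h => absurd rfl h, fun _ hx => h.ne x y hx⟩,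
        fun _ hx => (h.ne x y hx).symm, fun h => absurd rfl h⟩

/-- Colorings extend along an embedding whose image carries every edge. -/
theorem SEPair.map {V W : Type*} [Nonempty W] {H : SimpleGraph W} {G : SimpleGraph V}
    {c d : W → W → ℕ} (h : SEPair H c d) (f : W → V) (hf : Function.Injective f)
    (hG : ∀ a b, G.Adj a b ↔ ∃ x y, f x = a ∧ f y = b ∧ H.Adj x y) :
    SEPair G (fun a b => c (Function.invFun f a) (Function.invFun f b))
      (fun a b => d (Function.invFun f a) (Function.invFun f b)) := by
  have hi : ∀ x, Function.invFun f (f x) = x := Function.leftInverse_invFun hf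
  have hv : ∀ v x, G.Adj v x → ∃ p q, v = f p ∧ x = f q ∧ H.Adj p q := by
    intro v x hx
    obtain ⟨p, q, rfl, rfl, h⟩ := (hG _ _).1 hx
    exact ⟨p, q, rfl, rfl, h⟩
  have hv' : ∀ p x, G.Adj (f p) x → ∃ q, x = f q ∧ H.Adj p q := by
    intro p x hx
    obtain ⟨p', q, h1, h2, h⟩ := hv _ _ hx
    exact ⟨q, h2, hf h1 ▸ h⟩
  constructor
  · exact fun x y => h.symm_left _ _
  · exact fun x y => h.symm_right _ _
  · intro v x y hx hy e
    obtain ⟨p, q, rfl, rfl, hpq⟩ := hv _ _ hx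
    obtain ⟨r, rfl, hpr⟩ := hv' _ _ hy
    simp only [hi] at e
    rw [h.inj_left p q r hpq hpr e]
  · intro v x y hx hy e
    obtain ⟨p, q, rfl, rfl, hpq⟩ := hv _ _ hx
    obtain ⟨r, rfl, hpr⟩ := hv' _ _ hy
    simp only [hi] at e
    rw [h.inj_right p q r hpq hpr e]
  · intro v x hx
    obtain ⟨p, q, rfl, rfl, hpq⟩ := hv _ _ hx
    obtain ⟨r, hr, e⟩ := h.exists_right _ _ hpq
    exact ⟨f r, (hG _ _).2 ⟨p, r, rfl, rfl, hr⟩, by simpa only [hi] using e⟩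
  · intro v x hx
    obtain ⟨p, q, rfl, rfl, hpq⟩ := hv _ _ hx
    obtain ⟨r, hr, e⟩ := h.exists_left _ _ hpq
    exact ⟨f r, (hG _ _).2 ⟨p, r, rfl, rfl, hr⟩, by simpa only [hi] using e⟩
  · intro v x hx
    obtain ⟨p, q, rfl, rfl, hpq⟩ := hv _ _ hx
    simpa only [hi] using h.ne _ _ hpq

/-- The union of two edge-disjoint colorable graphs is colorable. -/
theorem exists_sePair_of_union {V : Type*} {G H₁ H₂ : SimpleGraph V}
    (h₁ : ∃ c d, SEPair H₁ c d) (h₂ : ∃ c d, SEPair H₂ c d)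
    (hG : ∀ a b, G.Adj a b ↔ H₁.Adj a b ∨ H₂.Adj a b)
    (hd : ∀ a b, H₁.Adj a b → ¬ H₂.Adj a b) : ∃ c d, SEPair G c d := by
  classical
  obtain ⟨c₁, d₁, h₁⟩ := h₁
  obtain ⟨c₂, d₂, h₂⟩ := h₂
  refine ⟨fun a b => if H₁.Adj a b then 2 * c₁ a b else 2 * c₂ a b + 1,
    fun a b => if H₁.Adj a b then 2 * d₁ a b else 2 * d₂ a b + 1, ?_, ?_, ?_, ?_, ?_, ?_, ?_⟩
  · intro x y; simp only [H₁.adj_comm x y, h₁.symm_left x y, h₂.symm_left x y]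
  · intro x y; simp only [H₁.adj_comm x y, h₁.symm_right x y, h₂.symm_right x y]
  · intro v x y hx hy e
    have := h₁.inj_left v x y
    have := h₂.inj_left v x y
    grind
  · intro v x y hx hy e
    have := h₁.inj_right v x y
    have := h₂.inj_right v x y
    grind
  · intro v x hx
    have := h₁.exists_right v x
    have := h₂.exists_right v x
    grind
  · intro v x hx
    have := h₁.exists_left v x
    have := h₂.exists_left v x
    grind
  · intro v x hx
    have := h₁.ne v x
    have := h₂.ne v x
    grind

/-- The vertices reached from `z` by first following an edge with `d`-color `k` into `P`, and then
repeatedly an edge with `c`-color `k` and an edge with `d`-color `k`, without returning to `z`. -/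
inductive Reach {V : Type*} (G : SimpleGraph V) (z : V) (P : Set V) (c d : V → V → ℕ) (k : ℕ) :
    V → Prop
  | start (a : V) : G.Adj z a → a ∈ P → d z a = k → Reach G z P c d k a
  | step (a b x : V) : Reach G z P c d k a → b ≠ z → G.Adj a b → c a b = k → G.Adj b x →
      d b x = k → Reach G z P c d k x

/-- Colorings of the graph obtained from `G` by splitting the vertex `z` into a vertex adjacent
to the neighbors of `z` in `P` and a vertex adjacent to the other neighbors. -/
structure SplitPair {V : Type*} (G : SimpleGraph V) (z : V) (P : Set V) (c d : V → V → ℕ) :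
    Prop where
  symm_left : ∀ x y, c x y = c y x
  symm_right : ∀ x y, d x y = d y x
  inj_left : ∀ v x y, G.Adj v x → G.Adj v y → (v = z → (x ∈ P ↔ y ∈ P)) → c v x = c v y → x = y
  inj_right : ∀ v x y, G.Adj v x → G.Adj v y → (v = z → (x ∈ P ↔ y ∈ P)) → d v x = d v y → x = y
  exists_right : ∀ v x, G.Adj v x → ∃ y, G.Adj v y ∧ (v = z → (x ∈ P ↔ y ∈ P)) ∧ d v y = c v x
  exists_left : ∀ v x, G.Adj v x → ∃ y, G.Adj v y ∧ (v = z → (x ∈ P ↔ y ∈ P)) ∧ c v y = d v x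
  ne : ∀ v x, G.Adj v x → c v x ≠ d v x

section Merge

variable {V : Type*} {G : SimpleGraph V} {z : V} {P : Set V} {c d : V → V → ℕ} {k : ℕ}

theorem Reach.side_ne {s : V → Prop} (hs : ∀ a b, G.Adj a b → (s b ↔ ¬ s a)) {a : V}
    (h : Reach G z P c d k a) : ¬ (s a ↔ s z) := by
  induction h with
  | start a h1 h2 h3 => have := hs _ _ h1; grind
  | step a b a' h1 h2 h3 h4 h5 h6 ih =>
    have := hs _ _ h3
    have := hs _ _ h5
    grind

theorem Reach.exists_start {a : V} (h : Reach G z P c d k a) :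
    ∃ a, G.Adj z a ∧ a ∈ P ∧ d z a = k := by
  induction h with
  | start a h1 h2 h3 => exact ⟨a, h1, h2, h3⟩
  | step a b a' h1 h2 h3 h4 h5 h6 ih => exact ih

theorem Reach.exists_adj {a : V} (h : Reach G z P c d k a) : ∃ b, G.Adj b a ∧ d b a = k := by
  cases h with
  | start _ h1 h2 h3 => exact ⟨z, h1, h3⟩
  | step a b _ h1 h2 h3 h4 h5 h6 => exact ⟨b, h5, h6⟩

theorem SplitPair.not_reach (h : SplitPair G z P c d) {y : V} (hy : G.Adj z y) (hP : y ∉ P) :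
    ¬ Reach G z P c d (d z y) y := by
  generalize hk : d z y = k
  intro hr
  cases hr with
  | start _ h1 h2 h3 => exact hP h2
  | step a b _ h1 h2 h3 h4 h5 h6 =>
    have h7 := h.symm_right b y
    have h8 := h.symm_right z y
    exact h2 (h.inj_right y b z h5.symm hy.symm (fun e => absurd e hy.ne') (by grind))

theorem SplitPair.reach_iff (h : SplitPair G z P c d) {b x y : V} (hb : b ≠ z) (hx : G.Adj b x)
    (hy : G.Adj b y) (hyz : y ≠ z) (hc : c b x = k) (hd : d b y = k) :
    Reach G z P c d k x ↔ Reach G z P c d k y := by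
  constructor
  · intro hr
    exact .step x b y hr hb hx.symm (by rw [h.symm_left, hc]) hy hd
  · intro hr
    cases hr with
    | start _ h1 h2 h3 =>
      exact absurd (h.inj_right y b z hy.symm h1.symm (fun e => absurd e hyz)
        (by rw [h.symm_right y b, h.symm_right y z, hd, h3])) hb
    | step a b' _ h1 h2 h3 h4 h5 h6 =>
      obtain rfl := h.inj_right y b' b h5.symm hy.symm (fun e => absurd e hyz)
        (by rw [h.symm_right y b, h.symm_right y b', hd, h6])
      obtain rfl := h.inj_left b' a x h3.symm hx (fun e => absurd e hb)
        (by rw [h.symm_left b' a, h4, hc])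
      exact h1

theorem SplitPair.existsUnique_reach [Finite V] (h : SplitPair G z P c d) {s : V → Prop}
    (hs : ∀ a b, G.Adj a b → (s b ↔ ¬ s a)) {a₀ : V} (h₀ : G.Adj z a₀) (hP : a₀ ∈ P)
    (hk : d z a₀ = k) :
    ∃! a, Reach G z P c d k a ∧ G.Adj z a ∧ c z a = k := by
  set Q : Set V := {a | Reach G z P c d k a} with hQ
  set Z : Set V := {a | Reach G z P c d k a ∧ G.Adj z a ∧ c z a = k} with hZ
  have ha₀ : a₀ ∈ Q := Reach.start a₀ h₀ hP hk
  have hQz : ∀ a ∈ Q, a ≠ z := fun a ha e => Reach.side_ne hs ha (by rw [e])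
  have hnext : ∀ a ∈ Q \ Z, ∃ a' b, b ≠ z ∧ G.Adj a b ∧ c a b = k ∧ G.Adj b a' ∧ d b a' = k := by
    rintro a ⟨ha, hZa⟩
    obtain ⟨b₀, hb₀, hd⟩ := ha.exists_adj
    obtain ⟨b, hb, -, hc⟩ := h.exists_left a b₀ hb₀.symm
    rw [h.symm_right, hd] at hc
    have hbz : b ≠ z := by
      rintro rfl
      exact hZa ⟨ha, hb.symm, by rw [h.symm_left, hc]⟩
    obtain ⟨a', ha', -, hd'⟩ := h.exists_right b a hb.symm
    exact ⟨a', b, hbz, hb, hc, ha', by rw [hd', h.symm_left, hc]⟩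
  choose! f g hf using hnext
  have hmem : ∀ a ∈ Q \ Z, f a ∈ Q := fun a ha =>
    let ⟨h1, h2, h3, h4, h5⟩ := hf a ha
    Reach.step a (g a) (f a) ha.1 h1 h2 h3 h4 h5
  have hcard : (Q \ Z).ncard = (Q \ {a₀}).ncard := by
    refine Set.ncard_congr (fun a _ => f a) ?_ ?_ ?_
    · intro a ha
      refine ⟨hmem a ha, fun e => ?_⟩
      rw [Set.mem_singleton_iff] at e
      obtain ⟨h1, h2, h3, h4, h5⟩ := hf a ha
      rw [e] at h4 h5
      refine h1 (h.inj_right a₀ (g a) z h4.symm h₀.symm (fun e => absurd e (hQz _ ha₀)) ?_)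
      rw [h.symm_right a₀, h5, h.symm_right a₀, hk]
    · intro a a' ha ha' (e : f a = f a')
      obtain ⟨h1, h2, h3, h4, h5⟩ := hf a ha
      obtain ⟨h1', h2', h3', h4', h5'⟩ := hf a' ha'
      have hg : g a = g a' := by
        refine h.inj_right (f a) _ _ h4.symm (by rw [e]; exact h4'.symm)
          (fun e => absurd e (hQz _ (hmem a ha))) ?_
        rw [h.symm_right, h5, e, h.symm_right, h5']
      refine h.inj_left (g a) _ _ h2.symm (by rw [hg]; exact h2'.symm) (fun e => absurd e h1) ?_
      rw [h.symm_left, h3, hg, h.symm_left, h3']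
    · rintro a' ⟨ha', hne⟩
      have hr : Reach G z P c d k a' := ha'
      cases hr with
      | start _ h1 h2 h3 =>
        exact absurd (h.inj_right z a' a₀ h1 h₀ (fun _ => by simp [h2, hP]) (by rw [h3, hk])) hne
      | step a b _ h1 h2 h3 h4 h5 h6 =>
        have ha : a ∈ Q \ Z := by
          refine ⟨h1, fun hZa => h2 ?_⟩
          refine h.inj_left a b z h3 hZa.2.1.symm (fun e => absurd e (hQz _ h1)) ?_
          rw [h4, h.symm_left, hZa.2.2]
        refine ⟨a, ha, ?_⟩
        obtain ⟨h1', h2', h3', h4', h5'⟩ := hf a ha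
        have hg : g a = b := h.inj_left a _ _ h2' h3 (fun e => absurd e (hQz _ h1)) (by rw [h3', h4])
        rw [hg] at h4' h5'
        exact h.inj_right b _ _ h4' h5 (fun e => absurd e h2) (by rw [h5', h6])
  have h1 := Set.ncard_sdiff_add_ncard_of_subset (s := Z) (t := Q) (fun a ha => ha.1)
  have h2 := Set.ncard_sdiff_add_ncard_of_subset (s := {a₀}) (t := Q) (by simpa using ha₀)
  rw [Set.ncard_singleton] at h2
  have h3 : Z.ncard = 1 := by omega
  obtain ⟨a, ha⟩ := Set.ncard_eq_one.1 h3
  have hm : ∀ b, b ∈ Z ↔ b = a := fun b => by rw [ha]; rfl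
  exact ⟨a, (hm a).2 rfl, fun b hb => (hm b).1 hb⟩

/-- If a bipartite graph is colored except that the edges at `z` are only balanced separately on
the neighbors inside `P` and outside `P`, then it is colorable: each color cycle through `z` in
both parts is cut at `z` into two cycles. -/
theorem SplitPair.exists_sePair [Finite V] (h : SplitPair G z P c d) {s : V → Prop}
    (hs : ∀ a b, G.Adj a b → (s b ↔ ¬ s a)) : ∃ c' d', SEPair G c' d' := by
  classical
  set R := Reach G z P c d with hR
  set c' : V → V → ℕ := fun x y => 2 * c x y + if R (c x y) x ∨ R (c x y) y then 1 else 0 with hc'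
  set d' : V → V → ℕ := fun x y => 2 * d x y + if R (d x y) x ∨ R (d x y) y then 1 else 0 with hd'
  have hside : ∀ k a, R k a → ¬ (s a ↔ s z) := fun k a ha => ha.side_ne hs
  -- the flag of an edge is decided by its endpoint on the side opposite to `z`
  have flag_far : ∀ k v x, ¬ (s v ↔ s z) → G.Adj v x → ((R k v ∨ R k x) ↔ R k v) := by
    intro k v x hv hx
    have := hs _ _ hx
    have := hside k x
    grind
  have flag_near : ∀ k v x, (s v ↔ s z) → G.Adj v x → ((R k v ∨ R k x) ↔ R k x) := by
    intro k v x hv hx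
    have := hside k v
    grind
  have code : ∀ (m n : ℕ) (p q : Prop) [Decidable p] [Decidable q],
      (2 * m + if p then 1 else 0) = (2 * n + if q then 1 else 0) ↔ m = n ∧ (p ↔ q) := by
    intro m n p q _ _
    by_cases p <;> by_cases q <;> simp_all <;> omega
  have hfar : ∀ v x y, ¬ (s v ↔ s z) → G.Adj v x → G.Adj v y → (c v x = d v y ↔ c' v x = d' v y) := by
    intro v x y hv hx hy
    simp only [hc', hd', code, flag_far _ v x hv hx, flag_far _ v y hv hy]
    grind
  have hnear : ∀ v x y, (s v ↔ s z) → v ≠ z → G.Adj v x → G.Adj v y →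
      (c v x = d v y ↔ c' v x = d' v y) := by
    intro v x y hv hvz hx hy
    simp only [hc', hd', code, flag_near _ v x hv hx, flag_near _ v y hv hy]
    refine ⟨fun e => ⟨e, ?_⟩, fun e => e.1⟩
    have hyz : y ≠ z := by
      have := hs _ _ hy
      grind
    rw [← e]
    exact h.reach_iff hvz hx hy hyz rfl e.symm
  have hne : ∀ v x y, v ≠ z → G.Adj v x → G.Adj v y → (c v x = d v y ↔ c' v x = d' v y) := by
    intro v x y hvz hx hy
    by_cases hv : (s v ↔ s z)
    · exact hnear v x y hv hvz hx hy
    · exact hfar v x y hv hx hy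
  have uniq : ∀ x, G.Adj z x → x ∈ P → ∃! a, R (c z x) a ∧ G.Adj z a ∧ c z a = c z x := by
    intro x hx hP
    obtain ⟨y, hy, hyP, e⟩ := h.exists_right z x hx
    exact h.existsUnique_reach hs hy ((hyP rfl).1 hP) e
  have nr : ∀ y, G.Adj z y → (R (d z y) y ↔ y ∈ P) := fun y hy =>
    ⟨fun hr => by_contra fun hP => h.not_reach hy hP hr, fun hP => .start y hy hP rfl⟩
  have injz : ∀ x y, G.Adj z x → G.Adj z y → (x ∈ P ↔ y ∈ P) → c z x = c z y → x = y :=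
    fun x y hx hy hP e => h.inj_left z x y hx hy (fun _ => hP) e
  refine ⟨c', d', ?_, ?_, ?_, ?_, ?_, ?_, ?_⟩
  · intro x y; simp only [hc', h.symm_left x y, or_comm]
  · intro x y; simp only [hd', h.symm_right x y, or_comm]
  · intro v x y hx hy e
    simp only [hc', code] at e
    by_cases hP : v = z → (x ∈ P ↔ y ∈ P)
    · exact h.inj_left v x y hx hy hP e.1
    · obtain ⟨hv, hP⟩ := Classical.not_imp.1 hP
      subst hv
      rw [flag_near _ v x Iff.rfl hx, flag_near _ v y Iff.rfl hy] at e
      obtain ⟨e, hr⟩ := e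
      rw [← e] at hr
      by_cases hxP : x ∈ P
      · obtain ⟨a, ⟨ha, hva, hca⟩, hu⟩ := uniq x hx hxP
        have := hu x
        have := hu y
        have := injz a x hva hx
        have := injz a y hva hy
        grind
      · obtain ⟨a, ⟨ha, hva, hca⟩, hu⟩ := uniq y hy (by tauto)
        have := hu x
        have := hu y
        have := injz a x hva hx
        have := injz a y hva hy
        grind
  · intro v x y hx hy e
    simp only [hd', code] at e
    by_cases hP : v = z → (x ∈ P ↔ y ∈ P)
    · exact h.inj_right v x y hx hy hP e.1
    · obtain ⟨hv, hP⟩ := Classical.not_imp.1 hP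
      subst hv
      rw [flag_near _ v x Iff.rfl hx, flag_near _ v y Iff.rfl hy, nr x hx, nr y hy] at e
      exact absurd (fun _ => e.2) hP
  · intro v x hx
    by_cases hv : v = z
    · subst hv
      have key : ∃ y, G.Adj v y ∧ d v y = c v x ∧ (y ∈ P ↔ R (c v x) x) := by
        by_cases hr : R (c v x) x
        · obtain ⟨y, hy, hP, e⟩ := hr.exists_start
          exact ⟨y, hy, e, by simp [hP, hr]⟩
        · by_cases hxP : x ∈ P
          · obtain ⟨a, ⟨ha, hva, hca⟩, hu⟩ := uniq x hx hxP
            have haP : a ∉ P := fun haP => by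
              rw [injz a x hva hx (by simp [haP, hxP]) hca] at ha
              exact hr ha
            obtain ⟨y, hy, hyP, e⟩ := h.exists_right v a hva
            exact ⟨y, hy, by rw [e, hca], ⟨fun hy' => absurd ((hyP rfl).2 hy') haP,
              fun hr' => absurd hr' hr⟩⟩
          · obtain ⟨y, hy, hyP, e⟩ := h.exists_right v x hx
            exact ⟨y, hy, e, ⟨fun hy' => absurd ((hyP rfl).2 hy') hxP,
              fun hr' => absurd hr' hr⟩⟩
      obtain ⟨y, hy, e, hP⟩ := key
      refine ⟨y, hy, ?_⟩
      rw [code, flag_near _ v y Iff.rfl hy, flag_near _ v x Iff.rfl hx, nr y hy]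
      exact ⟨e, hP⟩
    · obtain ⟨y, hy, -, e⟩ := h.exists_right v x hx
      exact ⟨y, hy, ((hne v x y hv hx hy).1 e.symm).symm⟩
  · intro v x hx
    by_cases hv : v = z
    · subst hv
      have key : ∃ y, G.Adj v y ∧ c v y = d v x ∧ (R (d v x) y ↔ x ∈ P) := by
        obtain ⟨y, hy, hyP, e⟩ := h.exists_left v x hx
        have hyP := hyP rfl
        by_cases hxP : x ∈ P
        · obtain ⟨a, ⟨ha, hva, hca⟩, hu⟩ := uniq y hy (hyP.1 hxP)
          exact ⟨a, hva, by rw [hca, e], by rw [← e]; simp [ha, hxP]⟩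
        · by_cases hr : R (d v x) y
          · obtain ⟨a, ha, haP, e'⟩ := hr.exists_start
            obtain ⟨y₁, hy₁, hyP₁, e₁⟩ := h.exists_left v a ha
            have hyP₁ := (hyP₁ rfl).1 haP
            refine ⟨y₁, hy₁, by rw [e₁, e'], ?_⟩
            obtain ⟨b, -, hu⟩ := uniq y₁ hy₁ hyP₁
            have := hu y
            have := hu y₁
            grind
          · exact ⟨y, hy, e, by simp [hr, hxP]⟩
      obtain ⟨y, hy, e, hP⟩ := key
      refine ⟨y, hy, ?_⟩
      rw [code, flag_near _ v y Iff.rfl hy, flag_near _ v x Iff.rfl hx, nr x hx]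
      exact ⟨e, by rw [e]; exact hP⟩
    · obtain ⟨y, hy, -, e⟩ := h.exists_left v x hx
      exact ⟨y, hy, (hne v y x hv hy hx).1 e⟩
  · intro v x hx e
    simp only [hc', hd', code] at e
    exact h.ne v x hx e.1

end Merge

theorem TwoCross.of_compl {V : Type*} {G : SimpleGraph V} {S : Set V} (h : TwoCross G Sᶜ) :
    TwoCross G S := by
  obtain ⟨a, b, a', b', ha, hb, hab, ha', hb', hab', hne⟩ := h
  exact ⟨b, a, b', a', not_not.1 hb, ha, hab.symm, not_not.1 hb', ha', hab'.symm, hne.symm⟩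

theorem exists_side_of_colorable {V : Type*} {G : SimpleGraph V} (h : G.Colorable 2) :
    ∃ s : V → Prop, ∀ a b, G.Adj a b → (s b ↔ ¬ s a) := by
  obtain ⟨C⟩ := h
  refine ⟨fun x => C x = 0, fun a b hab => ?_⟩
  have := C.valid hab
  change C b = 0 ↔ ¬ C a = 0
  grind

theorem colorable_of_side {V : Type*} {G : SimpleGraph V} {s : V → Prop}
    (hs : ∀ a b, G.Adj a b → (s b ↔ ¬ s a)) : G.Colorable 2 := by
  classical
  have C : G.Coloring Bool := Coloring.mk (fun x => decide (s x)) (fun {a b} hab => by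
    have := hs a b hab
    simp only [ne_eq, decide_eq_decide]
    tauto)
  simpa using C.colorable

/-- A bridgeless bipartite graph without a `2`-simultaneous edge coloring which has the minimum
number of edges and, subject to that, the maximum number of vertices. -/
structure IsExtremal {V : Type} [Finite V] (G : SimpleGraph V) : Prop where
  nonempty : Nonempty V
  cross : ∀ S : Set V, S.Nonempty → Sᶜ.Nonempty → TwoCross G S
  side : ∃ s : V → Prop, ∀ a b, G.Adj a b → (s b ↔ ¬ s a)
  not_sePair : ¬ ∃ c d, SEPair G c d
  of_ncard_lt : ∀ {W : Type} [Finite W] [Nonempty W] (H : SimpleGraph W),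
    (∀ S : Set W, S.Nonempty → Sᶜ.Nonempty → TwoCross H S) →
    (∃ s : W → Prop, ∀ a b, H.Adj a b → (s b ↔ ¬ s a)) →
    H.edgeSet.ncard < G.edgeSet.ncard → ∃ c d, SEPair H c d
  of_ncard_eq : ∀ {W : Type} [Finite W] [Nonempty W] (H : SimpleGraph W),
    (∀ S : Set W, S.Nonempty → Sᶜ.Nonempty → TwoCross H S) →
    (∃ s : W → Prop, ∀ a b, H.Adj a b → (s b ↔ ¬ s a)) →
    H.edgeSet.ncard = G.edgeSet.ncard → Nat.card V < Nat.card W → ∃ c d, SEPair H c d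

/-- Every finite graph has a copy on `Fin n` with the same relevant properties. -/
theorem exists_copy_fin {W : Type} [Finite W] [Nonempty W] (H : SimpleGraph W)
    (hcut : ∀ S : Set W, S.Nonempty → Sᶜ.Nonempty → TwoCross H S)
    (hside : ∃ s : W → Prop, ∀ a b, H.Adj a b → (s b ↔ ¬ s a)) :
    ∃ H' : SimpleGraph (Fin (Nat.card W)), IsKEdgeConnected H' 2 ∧ H'.Colorable 2 ∧
      H'.edgeSet.ncard = H.edgeSet.ncard ∧
      (SimultaneousEdgeColorable H' 2 → ∃ c d, SEPair H c d) := by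
  let e := Finite.equivFin W
  let I : H.comap e.symm ≃g H := SimpleGraph.Iso.comap e.symm H
  obtain ⟨s, hs⟩ := hside
  refine ⟨H.comap e.symm, ?_, ?_, ?_, ?_⟩
  · rw [isKEdgeConnected_two_iff]
    refine ⟨⟨e (Classical.arbitrary W)⟩, fun S ⟨x, hx⟩ ⟨y, hy⟩ => ?_⟩
    obtain ⟨a, b, a', b', ha, hb, hab, ha', hb', hab', hne⟩ :=
      hcut (e ⁻¹' S) ⟨e.symm x, by simpa using hx⟩ ⟨e.symm y, by simpa using hy⟩
    exact ⟨e a, e b, e a', e b', ha, hb, by simpa using hab, ha', hb', by simpa using hab',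
      by simpa using hne⟩
  · exact colorable_of_side (s := fun x => s (e.symm x)) (fun a b hab => hs _ _ hab)
  · rw [← Nat.card_coe_set_eq, ← Nat.card_coe_set_eq]
    exact Nat.card_congr I.mapEdgeSet
  · rw [simultaneousEdgeColorable_two_iff]
    rintro ⟨c, d, h⟩
    have : Nonempty (Fin (Nat.card W)) := ⟨e (Classical.arbitrary W)⟩
    refine ⟨_, _, h.map e.symm e.symm.injective (fun a b => ?_)⟩
    constructor
    · intro hab
      exact ⟨e a, e b, by simp, by simp, by simpa using hab⟩
    · rintro ⟨x, y, rfl, rfl, hxy⟩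
      exact hxy

/-- The simple graph obtained by identifying vertices along `r`. -/
def contraction {V : Type*} (G : SimpleGraph V) (r : V → V) : SimpleGraph V where
  Adj p q := p ≠ q ∧ ∃ a b, G.Adj a b ∧ r a = p ∧ r b = q
  symm := ⟨fun _ _ ⟨h, a, b, hab, ha, hb⟩ => ⟨h.symm, b, a, hab.symm, hb, ha⟩⟩
  loopless := ⟨fun _ h => h.1 rfl⟩

theorem contraction_adj {V : Type*} {G : SimpleGraph V} {r : V → V} {a b : V} (h : G.Adj a b)
    (hr : r a ≠ r b) : (contraction G r).Adj (r a) (r b) :=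
  ⟨hr, a, b, h, rfl, rfl⟩

namespace IsExtremal

variable {V : Type} [Finite V] {G : SimpleGraph V}

theorem exists_sePair_of_support (hG : IsExtremal G) (H : SimpleGraph V) (T : Set V)
    (hT : T.Nonempty) (hsupp : ∀ a b, H.Adj a b → a ∈ T)
    (hcut : ∀ S : Set V, (∃ t ∈ T, t ∈ S) → (∃ t ∈ T, t ∉ S) → TwoCross H S)
    (hside : ∃ s : V → Prop, ∀ a b, H.Adj a b → (s b ↔ ¬ s a))
    (hlt : H.edgeSet.ncard < G.edgeSet.ncard) : ∃ c d, SEPair H c d := by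
  have : Nonempty T := hT.to_subtype
  obtain ⟨s, hs⟩ := hside
  have key := hG.of_ncard_lt (H.induce T) ?_ ⟨fun x => s x, fun a b hab => hs _ _ hab⟩ ?_
  · obtain ⟨c, d, h⟩ := key
    refine ⟨_, _, h.map Subtype.val Subtype.val_injective (fun a b => ?_)⟩
    constructor
    · intro hab
      exact ⟨⟨a, hsupp _ _ hab⟩, ⟨b, hsupp _ _ hab.symm⟩, rfl, rfl, hab⟩
    · rintro ⟨x, y, rfl, rfl, hxy⟩
      exact hxy
  · rintro S ⟨x, hx⟩ ⟨y, hy⟩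
    obtain ⟨a, b, a', b', ha, hb, hab, ha', hb', hab', hne⟩ :=
      hcut (Subtype.val '' S) ⟨x, x.2, x, hx, rfl⟩ ⟨y, y.2, by simpa using hy⟩
    refine ⟨⟨a, hsupp _ _ hab⟩, ⟨b, hsupp _ _ hab.symm⟩, ⟨a', hsupp _ _ hab'⟩,
      ⟨b', hsupp _ _ hab'.symm⟩, ?_, ?_, hab, ?_, ?_, hab', ?_⟩
    · simp only [Set.mem_image, Subtype.exists, exists_and_right, exists_eq_right] at ha
      exact ha.2
    · exact fun hb' => hb ⟨_, hb', rfl⟩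
    · simp only [Set.mem_image, Subtype.exists, exists_and_right, exists_eq_right] at ha'
      exact ha'.2
    · exact fun h => hb' ⟨_, h, rfl⟩
    · simpa using hne
  · refine lt_of_le_of_lt ?_ hlt
    refine Set.ncard_le_ncard_of_injOn (Sym2.map Subtype.val) ?_
      (Sym2.map.injective Subtype.val_injective).injOn (Set.toFinite _)
    intro e he
    induction e with | h x y => exact he

theorem exists_sePair_contraction (hG : IsExtremal G) (r : V → V) {s : V → Prop}
    (hs : ∀ a b, G.Adj a b → r a ≠ r b → (s (r b) ↔ ¬ s (r a)))
    (hinj : ∀ a b a' b', G.Adj a b → G.Adj a' b' → r a ≠ r b → r a = r a' → r b = r b' →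
      a = a' ∧ b = b')
    (hcol : ∃ a b, G.Adj a b ∧ r a = r b) : ∃ c d, SEPair (contraction G r) c d := by
  obtain ⟨v₀⟩ := hG.nonempty
  refine hG.exists_sePair_of_support _ (Set.range r) ⟨r v₀, v₀, rfl⟩ ?_ ?_ ⟨s, ?_⟩ ?_
  · rintro p q ⟨-, a, b, -, rfl, -⟩
    exact ⟨a, rfl⟩
  · rintro S ⟨-, ⟨x, rfl⟩, hx⟩ ⟨-, ⟨y, rfl⟩, hy⟩
    obtain ⟨a, b, a', b', ha, hb, hab, ha', hb', hab', hne⟩ :=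
      hG.cross (r ⁻¹' S) ⟨x, hx⟩ ⟨y, hy⟩
    have h1 : r a ≠ r b := fun e => hb (by rw [Set.mem_preimage, ← e]; exact ha)
    have h2 : r a' ≠ r b' := fun e => hb' (by rw [Set.mem_preimage, ← e]; exact ha')
    refine ⟨r a, r b, r a', r b', ha, hb, contraction_adj hab h1, ha', hb',
      contraction_adj hab' h2, ?_⟩
    by_contra! h
    have := hinj a b a' b' hab hab' h1 h.1 h.2
    tauto
  · rintro p q ⟨hpq, a, b, hab, rfl, rfl⟩
    exact hs a b hab hpq
  · obtain ⟨a₀, b₀, h₀, e₀⟩ := hcol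
    have hsub : (contraction G r).edgeSet ⊆ Sym2.map r '' (G.edgeSet \ {s(a₀, b₀)}) := by
      intro e he
      induction e with | h p q => ?_
      obtain ⟨hpq, a, b, hab, rfl, rfl⟩ := he
      refine ⟨s(a, b), ⟨hab, fun e => hpq ?_⟩, rfl⟩
      rcases Sym2.eq_iff.1 e with ⟨rfl, rfl⟩ | ⟨rfl, rfl⟩
      · exact e₀
      · exact e₀.symm
    refine lt_of_le_of_lt ((Set.ncard_le_ncard hsub (Set.toFinite _)).trans
      (Set.ncard_image_le (Set.toFinite _))) ?_
    exact Set.ncard_sdiff_singleton_lt_of_mem h₀ (Set.toFinite _)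

theorem exists_adj (hG : IsExtremal G) {x y : V} (h : x ≠ y) : ∃ n, G.Adj x n := by
  obtain ⟨a, b, -, -, ha, -, hab, -⟩ := hG.cross {x} ⟨x, rfl⟩ ⟨y, fun e => h e.symm⟩
  rw [Set.mem_singleton_iff.1 ha] at hab
  exact ⟨b, hab⟩

/-- An extremal counterexample has no cut vertex. -/
theorem exists_adj_of_notMem (hG : IsExtremal G) {z : V} {A : Set V} (hz : z ∉ A)
    (hA : A.Nonempty) {y : V} (hy : y ∉ A) (hyz : y ≠ z) :
    ∃ a b, a ∈ A ∧ b ∉ A ∧ b ≠ z ∧ G.Adj a b := by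
  classical
  by_contra! hno
  obtain ⟨x, hx⟩ := hA
  obtain ⟨s, hs⟩ := hG.side
  have hno' : ∀ a b, G.Adj a b → a ∈ A → b ∉ A → b = z := fun a b hab ha hb => by
    by_contra hbz
    exact hno a b ha hb hbz hab
  obtain ⟨n, hn⟩ := hG.exists_adj hyz
  obtain ⟨n', hn'⟩ := hG.exists_adj (show x ≠ y from fun e => hy (e ▸ hx))
  have key : ∀ r : V → V, (r = (fun a => if a ∈ A then a else z) ∨
      r = (fun a => if a ∈ A then z else a)) → ∃ c d, SEPair (contraction G r) c d := by
    intro r hr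
    refine hG.exists_sePair_contraction r (s := s) ?_ ?_ ?_
    · intro a b hab
      have := hs a b hab
      have := hno' a b hab
      have := hno' b a hab.symm
      grind
    · intro a b a' b' hab hab'
      have := hno' a b hab
      have := hno' b a hab.symm
      have := hno' a' b' hab'
      have := hno' b' a' hab'.symm
      grind
    · have := hno' _ _ hn'
      have := hno' _ _ hn.symm
      rcases hr with rfl | rfl
      · exact ⟨y, n, hn, by grind⟩
      · exact ⟨x, n', hn', by grind⟩
  refine hG.not_sePair (exists_sePair_of_union (key _ (.inl rfl)) (key _ (.inr rfl)) ?_ ?_)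
  · intro a b
    constructor
    · intro hab
      have := hno' a b hab
      have := hno' b a hab.symm
      have := hab.ne
      by_cases hAab : a ∈ A ∨ b ∈ A
      · exact .inl ⟨by assumption, a, b, hab, by grind, by grind⟩
      · exact .inr ⟨by assumption, a, b, hab, by grind, by grind⟩
    · rintro (⟨hne, p, q, hpq, rfl, rfl⟩ | ⟨hne, p, q, hpq, rfl, rfl⟩)
      · have := hno' p q hpq
        have := hno' q p hpq.symm
        grind
      · have := hno' p q hpq
        have := hno' q p hpq.symm
        grind
  · rintro a b ⟨hne, p, q, hpq, hp, hq⟩ ⟨-, p', q', hpq', hp', hq'⟩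
    grind

end IsExtremal

/-- The graph obtained from `G` by splitting the vertex `z` into `some z` and `none`, where `none`
takes over the edges between `z` and `P`. -/
def splitGraph {V : Type*} (G : SimpleGraph V) (z : V) (P : Set V) : SimpleGraph (Option V) where
  Adj a b := G.Adj (a.getD z) (b.getD z) ∧ (a = none → b.getD z ∈ P) ∧
    (a = some z → b.getD z ∉ P) ∧ (b = none → a.getD z ∈ P) ∧ (b = some z → a.getD z ∉ P)
  symm := ⟨fun _ _ ⟨h, h1, h2, h3, h4⟩ => ⟨h.symm, h3, h4, h1, h2⟩⟩
  loopless := ⟨fun _ h => h.1.ne rfl⟩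

open Classical in
/-- The copy of `x` in the split graph at which the edge `xy` is attached. -/
noncomputable def splitEnd {V : Type*} (z : V) (P : Set V) (x y : V) : Option V :=
  if x = z ∧ y ∈ P then none else some x

section Split

variable {V : Type*} {G : SimpleGraph V} {z : V} {P : Set V}

theorem splitEnd_getD (x y : V) : (splitEnd z P x y).getD z = x := by
  unfold splitEnd
  split_ifs with h
  · exact h.1.symm
  · rfl

theorem splitEnd_eq_iff (v x y : V) :
    splitEnd z P v x = splitEnd z P v y ↔ (v = z → (x ∈ P ↔ y ∈ P)) := by
  unfold splitEnd
  grind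

theorem splitGraph_adj {x y : V} (h : G.Adj x y) :
    (splitGraph G z P).Adj (splitEnd z P x y) (splitEnd z P y x) := by
  refine ⟨by simpa only [splitEnd_getD] using h, ?_⟩
  simp only [splitEnd_getD]
  unfold splitEnd
  grind

theorem splitEnd_of_adj {a b : Option V} (h : (splitGraph G z P).Adj a b) :
    splitEnd z P (a.getD z) (b.getD z) = a := by
  obtain ⟨-, h1, h2, -, -⟩ := h
  unfold splitEnd
  cases a with
  | none => simp [h1 rfl]
  | some x =>
    simp only [Option.getD_some] at *
    grind

theorem ncard_edgeSet_splitGraph : (splitGraph G z P).edgeSet.ncard = G.edgeSet.ncard := by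
  have himg : Sym2.map (fun o : Option V => o.getD z) '' (splitGraph G z P).edgeSet =
      G.edgeSet := by
    ext e
    induction e with | h x y => ?_
    constructor
    · rintro ⟨e, he, hxy⟩
      induction e with | h a b => ?_
      rw [← hxy]
      exact he.1
    · intro h
      exact ⟨s(splitEnd z P x y, splitEnd z P y x), splitGraph_adj h,
        by simp only [Sym2.map_mk, splitEnd_getD]⟩
  rw [← himg, Set.InjOn.ncard_image]
  intro e he e' he' hee
  induction e with | h a b => ?_
  induction e' with | h a' b' => ?_
  have h1 := splitEnd_of_adj (a := a) (b := b) he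
  have h2 := splitEnd_of_adj (a := b) (b := a) he.symm
  have h3 := splitEnd_of_adj (a := a') (b := b') he'
  have h4 := splitEnd_of_adj (a := b') (b := a') he'.symm
  rcases Sym2.eq_iff.1 (show s(a.getD z, b.getD z) = s(a'.getD z, b'.getD z) from hee) with
    ⟨e1, e2⟩ | ⟨e1, e2⟩
  · rw [e1, e2] at h1 h2
    rw [← h1, h3, ← h2, h4]
  · rw [e1, e2] at h1 h2
    rw [← h1, h4, ← h2, h3, Sym2.eq_swap]

theorem exists_splitPair (h : ∃ c d, SEPair (splitGraph G z P) c d) :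
    ∃ c d, SplitPair G z P c d := by
  obtain ⟨c, d, h⟩ := h
  have lift : ∀ v x o, G.Adj v x → (splitGraph G z P).Adj (splitEnd z P v x) o →
      ∃ y, G.Adj v y ∧ (v = z → (x ∈ P ↔ y ∈ P)) ∧ splitEnd z P v y = splitEnd z P v x ∧
        splitEnd z P y v = o := by
    intro v x o hx ho
    have h1 := splitEnd_of_adj ho
    have h2 := splitEnd_of_adj ho.symm
    have h3 := ho.1
    rw [splitEnd_getD] at h1 h2 h3
    exact ⟨o.getD z, h3, (splitEnd_eq_iff _ _ _).1 h1.symm, h1, h2⟩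
  refine ⟨fun x y => c (splitEnd z P x y) (splitEnd z P y x),
    fun x y => d (splitEnd z P x y) (splitEnd z P y x), ?_, ?_, ?_, ?_, ?_, ?_, ?_⟩
  · exact fun x y => h.symm_left _ _
  · exact fun x y => h.symm_right _ _
  · intro v x y hx hy hP (e : c _ _ = c _ _)
    rw [← splitEnd_eq_iff] at hP
    have hx' := splitGraph_adj (z := z) (P := P) hx
    have hy' := splitGraph_adj (z := z) (P := P) hy
    rw [hP] at e hx'
    have := h.inj_left _ _ _ hx' hy' e
    rw [← splitEnd_getD (z := z) (P := P) x v, this, splitEnd_getD]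
  · intro v x y hx hy hP (e : d _ _ = d _ _)
    rw [← splitEnd_eq_iff] at hP
    have hx' := splitGraph_adj (z := z) (P := P) hx
    have hy' := splitGraph_adj (z := z) (P := P) hy
    rw [hP] at e hx'
    have := h.inj_right _ _ _ hx' hy' e
    rw [← splitEnd_getD (z := z) (P := P) x v, this, splitEnd_getD]
  · intro v x hx
    obtain ⟨o, ho, e⟩ := h.exists_right _ _ (splitGraph_adj (z := z) (P := P) hx)
    obtain ⟨y, hy, hP, h1, h2⟩ := lift v x o hx ho
    exact ⟨y, hy, hP, by rw [h1, h2, e]⟩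
  · intro v x hx
    obtain ⟨o, ho, e⟩ := h.exists_left _ _ (splitGraph_adj (z := z) (P := P) hx)
    obtain ⟨y, hy, hP, h1, h2⟩ := lift v x o hx ho
    exact ⟨y, hy, hP, by rw [h1, h2, e]⟩
  · exact fun v x hx => h.ne _ _ (splitGraph_adj hx)

end Split

namespace IsExtremal

variable {V : Type} [Finite V] {G : SimpleGraph V}

theorem twoCross_splitGraph (hG : IsExtremal G) {z : V} {P : Set V} {p p' q r : V}
    (hp : G.Adj z p) (hp' : G.Adj z p') (hq : G.Adj z q) (hr : G.Adj z r) (hpP : p ∈ P)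
    (hpP' : p' ∈ P) (hqP : q ∉ P) (hrP : r ∉ P) (hpp : p ≠ p') (hqr : q ≠ r)
    (hbad : ¬ ∃ A : Set V, z ∉ A ∧ (∀ t, G.Adj z t → (t ∈ P ↔ t ∈ A)) ∧
      ∀ a b a' b', a ∈ A → b ∉ A → b ≠ z → G.Adj a b → a' ∈ A → b' ∉ A → b' ≠ z → G.Adj a' b' →
        a = a' ∧ b = b')
    (S : Set (Option V)) (hS : S.Nonempty) (hSc : Sᶜ.Nonempty) :
    TwoCross (splitGraph G z P) S := by
  have hnone : ∀ t, G.Adj z t → t ∈ P → (splitGraph G z P).Adj none (some t) := by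
    intro t ht htP
    refine ⟨ht, fun _ => htP, by simp, by simp, fun e => ?_⟩
    exact absurd (Option.some.inj e) ht.ne'
  have hsome : ∀ t, G.Adj z t → t ∉ P → (splitGraph G z P).Adj (some z) (some t) := by
    intro t ht htP
    refine ⟨ht, by simp, fun _ => htP, by simp, fun e => ?_⟩
    exact absurd (Option.some.inj e) ht.ne'
  have hrest : ∀ a b, G.Adj a b → a ≠ z → b ≠ z → (splitGraph G z P).Adj (some a) (some b) := by
    intro a b hab ha hb
    exact ⟨hab, by simp, fun e => absurd (Option.some.inj e) ha, by simp,
      fun e => absurd (Option.some.inj e) hb⟩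
  by_cases hsep : none ∈ S ↔ some z ∈ S
  · have hmem : ∀ x y, splitEnd z P x y ∈ S ↔ some x ∈ S := by
      intro x y
      unfold splitEnd
      grind
    obtain ⟨a, b, a', b', ha, hb, hab, ha', hb', hab', hne⟩ := hG.cross {x | some x ∈ S} (by
        obtain ⟨o, ho⟩ := hS
        cases o with
        | none => exact ⟨z, hsep.1 ho⟩
        | some x => exact ⟨x, ho⟩) (by
        obtain ⟨o, ho⟩ := hSc
        cases o with
        | none => exact ⟨z, fun h => ho (hsep.2 h)⟩
        | some x => exact ⟨x, ho⟩)
    refine ⟨_, _, _, _, (hmem a b).2 ha, fun h => hb ((hmem b a).1 h), splitGraph_adj hab,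
      (hmem a' b').2 ha', fun h => hb' ((hmem b' a').1 h), splitGraph_adj hab', ?_⟩
    by_contra! h
    have h1 := congrArg (fun o : Option V => o.getD z) h.1
    have h2 := congrArg (fun o : Option V => o.getD z) h.2
    simp only [splitEnd_getD] at h1 h2
    tauto
  · have key : ∀ S : Set (Option V), none ∈ S → some z ∉ S → TwoCross (splitGraph G z P) S := by
      intro S hnS hzS
      set A : Set V := {x | some x ∈ S} with hA
      by_cases hAne : A.Nonempty
      · by_cases hAc : ∃ y, y ∉ A ∧ y ≠ z
        · obtain ⟨y, hy, hyz⟩ := hAc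
          obtain ⟨a, b, ha, hb, hbz, hab⟩ := hG.exists_adj_of_notMem (z := z) hzS hAne hy hyz
          have haz : a ≠ z := fun e => hzS (e ▸ ha)
          have hab' := hrest a b hab haz hbz
          by_contra hno
          refine hbad ⟨A, hzS, ?_, ?_⟩
          · intro t ht
            constructor
            · intro htP
              by_contra htA
              exact hno ⟨none, some t, some a, some b, hnS, htA, hnone t ht htP, ha, hb, hab',
                by simp⟩
            · intro htA
              by_contra htP
              refine hno ⟨some t, some z, some a, some b, htA, hzS, (hsome t ht htP).symm, ha, hb,
                hab', .inr fun e => hbz (Option.some.inj e).symm⟩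
          · intro a₁ b₁ a₂ b₂ h1 h2 h3 h4 h5 h6 h7 h8
            by_contra hne
            refine hno ⟨some a₁, some b₁, some a₂, some b₂, h1, h2,
              hrest _ _ h4 (fun e => hzS (e ▸ h1)) h3, h5, h6,
              hrest _ _ h8 (fun e => hzS (e ▸ h5)) h7, ?_⟩
            simp only [ne_eq, Option.some.injEq]
            tauto
        · push Not at hAc
          have hin : ∀ t, G.Adj z t → some t ∈ S := fun t ht => by
            by_contra h
            exact ht.ne' (hAc t h)
          exact ⟨some q, some z, some r, some z, hin q hq, hzS, (hsome q hq hqP).symm, hin r hr,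
            hzS, (hsome r hr hrP).symm, by simp [hqr]⟩
      · have hout : ∀ t, some t ∉ S := fun t ht => hAne ⟨t, ht⟩
        exact ⟨none, some p, none, some p', hnS, hout p, hnone p hp hpP, hnS, hout p',
          hnone p' hp' hpP', by simp [hpp]⟩
    have key' : ∀ S : Set (Option V), none ∉ S → some z ∈ S → TwoCross (splitGraph G z P) S :=
      fun S h1 h2 => TwoCross.of_compl (key Sᶜ h1 (not_not.2 h2))
    by_cases h : none ∈ S
    · exact key S h (by tauto)
    · exact key' S h (by tauto)

theorem exists_bad_cut (hG : IsExtremal G) {z : V} {P : Set V} {p p' q r : V}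
    (hp : G.Adj z p) (hp' : G.Adj z p') (hq : G.Adj z q) (hr : G.Adj z r) (hpP : p ∈ P)
    (hpP' : p' ∈ P) (hqP : q ∉ P) (hrP : r ∉ P) (hpp : p ≠ p') (hqr : q ≠ r) :
    ∃ A : Set V, z ∉ A ∧ (∀ t, G.Adj z t → (t ∈ P ↔ t ∈ A)) ∧
      ∀ a b a' b', a ∈ A → b ∉ A → b ≠ z → G.Adj a b → a' ∈ A → b' ∉ A → b' ≠ z → G.Adj a' b' →
        a = a' ∧ b = b' := by
  by_contra hbad
  obtain ⟨s, hs⟩ := hG.side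
  obtain ⟨c, d, h⟩ := exists_splitPair <| hG.of_ncard_eq (splitGraph G z P)
    (hG.twoCross_splitGraph hp hp' hq hr hpP hpP' hqP hrP hpp hqr hbad)
    ⟨fun o => s (o.getD z), fun a b hab => hs _ _ hab.1⟩ ncard_edgeSet_splitGraph
    (by rw [Finite.card_option]; omega)
  exact hG.not_sePair (h.exists_sePair hs)

/-- Every vertex of an extremal counterexample has degree at most three. -/
theorem not_four_adj (hG : IsExtremal G) {z p p' q r : V} (hp : G.Adj z p) (hp' : G.Adj z p')
    (hq : G.Adj z q) (hr : G.Adj z r) (h1 : p ≠ p') (h2 : p ≠ q) (h3 : p ≠ r) (h4 : p' ≠ q)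
    (h5 : p' ≠ r) (h6 : q ≠ r) : False := by
  obtain ⟨A, hzA, hA, hAu⟩ := hG.exists_bad_cut (P := {p, p'}) hp hp' hq hr (by simp) (by simp)
    (by simp [h2.symm, h4.symm]) (by simp [h3.symm, h5.symm]) h1 h6
  obtain ⟨B, hzB, hB, hBu⟩ := hG.exists_bad_cut (P := {p, q}) hp hq hp' hr (by simp) (by simp)
    (by simp [h1.symm, h4]) (by simp [h3.symm, h6.symm]) h2 h5
  simp only [Set.mem_insert_iff, Set.mem_singleton_iff] at hA hB
  have pA := (hA p hp).1 (by simp)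
  have pA' := (hA p' hp').1 (by simp)
  have qA := (hA q hq).not.1 (by grind)
  have rA := (hA r hr).not.1 (by grind)
  have pB := (hB p hp).1 (by simp)
  have qB := (hB q hq).1 (by simp)
  have pB' := (hB p' hp').not.1 (by grind)
  have rB := (hB r hr).not.1 (by grind)
  have corner : ∀ C : Set V, z ∉ C → C.Nonempty → ∀ y, y ∉ C → y ≠ z →
      ∃ a b, a ∈ C ∧ b ∉ C ∧ b ≠ z ∧ G.Adj a b := fun C hz hC y hy hyz =>
    hG.exists_adj_of_notMem hz hC hy hyz
  obtain ⟨a₁, b₁, ha₁, hb₁, hz₁, hab₁⟩ := corner (A ∩ B) (by simp [hzA]) ⟨p, pA, pB⟩ q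
    (by simp [qA]) hq.ne'
  obtain ⟨a₂, b₂, ha₂, hb₂, hz₂, hab₂⟩ := corner (A \ B) (by simp [hzA]) ⟨p', pA', pB'⟩ q
    (by simp [qA]) hq.ne'
  obtain ⟨a₃, b₃, ha₃, hb₃, hz₃, hab₃⟩ := corner (B \ A) (by simp [hzB]) ⟨q, qB, qA⟩ p
    (by simp [pA]) hp.ne'
  obtain ⟨a₄, b₄, ha₄, hb₄, hz₄, hab₄⟩ := corner {x | x ∉ A ∧ x ∉ B ∧ x ≠ z} (by simp)
    ⟨r, rA, rB, hr.ne'⟩ p (by simp [pA]) hp.ne'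
  have sym : ∀ C : Set V, (∀ a b a' b', a ∈ C → b ∉ C → b ≠ z → G.Adj a b → a' ∈ C → b' ∉ C →
      b' ≠ z → G.Adj a' b' → a = a' ∧ b = b') → ∀ a b a' b', a ≠ z → b ≠ z → G.Adj a b →
      a' ≠ z → b' ≠ z → G.Adj a' b' → (a ∈ C ↔ b ∉ C) → (a' ∈ C ↔ b' ∉ C) →
      (a = a' ∧ b = b') ∨ (a = b' ∧ b = a') := by
    intro C hC a b a' b' ha hb hab ha' hb' hab' h h'
    by_cases h1 : a ∈ C <;> by_cases h2 : a' ∈ C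
    · exact .inl (hC a b a' b' h1 (h.1 h1) hb hab h2 (h'.1 h2) hb' hab')
    · have := hC a b b' a' h1 (h.1 h1) hb hab (by tauto) h2 ha' hab'.symm
      tauto
    · have := hC b a a' b' (by tauto) h1 ha hab.symm h2 (h'.1 h2) hb' hab'
      tauto
    · have := hC b a b' a' (by tauto) h1 ha hab.symm (by tauto) h2 ha' hab'.symm
      tauto
  have hA' := sym A hAu
  have hB' := sym B hBu
  simp only [Set.mem_inter_iff, Set.mem_sdiff, Set.mem_ofPred_eq]
    at ha₁ ha₂ ha₃ ha₄ hb₁ hb₂ hb₃ hb₄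
  have za₁ : a₁ ≠ z := fun e => hzA (e ▸ ha₁.1)
  have za₂ : a₂ ≠ z := fun e => hzA (e ▸ ha₂.1)
  have za₃ : a₃ ≠ z := fun e => hzB (e ▸ ha₃.1)
  have za₄ : a₄ ≠ z := ha₄.2.2
  have A₁₂ := hA' _ _ _ _ za₁ hz₁ hab₁ za₂ hz₂ hab₂
  have A₁₃ := hA' _ _ _ _ za₁ hz₁ hab₁ za₃ hz₃ hab₃
  have A₁₄ := hA' _ _ _ _ za₁ hz₁ hab₁ za₄ hz₄ hab₄
  have A₂₃ := hA' _ _ _ _ za₂ hz₂ hab₂ za₃ hz₃ hab₃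
  have A₂₄ := hA' _ _ _ _ za₂ hz₂ hab₂ za₄ hz₄ hab₄
  have A₃₄ := hA' _ _ _ _ za₃ hz₃ hab₃ za₄ hz₄ hab₄
  have B₁₂ := hB' _ _ _ _ za₁ hz₁ hab₁ za₂ hz₂ hab₂
  have B₁₃ := hB' _ _ _ _ za₁ hz₁ hab₁ za₃ hz₃ hab₃
  have B₁₄ := hB' _ _ _ _ za₁ hz₁ hab₁ za₄ hz₄ hab₄
  have B₂₃ := hB' _ _ _ _ za₂ hz₂ hab₂ za₃ hz₃ hab₃
  have B₂₄ := hB' _ _ _ _ za₂ hz₂ hab₂ za₄ hz₄ hab₄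
  have B₃₄ := hB' _ _ _ _ za₃ hz₃ hab₃ za₄ hz₄ hab₄
  clear corner hA hB hAu hBu hA' hB' sym
  grind (splits := 30)

end IsExtremal

/-- A coloring of `G - v`, where `v` has neighbors `u` and `w`, extends to `G` if some common
neighbor `z` of `u` and `w` has `c z u = d z w`. -/
theorem exists_sePair_of_delete {V : Type*} {G H : SimpleGraph V} {v u w z : V} {c d : V → V → ℕ}
    (h : SEPair H c d) (hH : ∀ a b, H.Adj a b ↔ G.Adj a b ∧ a ≠ v ∧ b ≠ v)
    (hv : ∀ t, G.Adj v t ↔ t = u ∨ t = w) (huw : u ≠ w) (hzu : G.Adj z u) (hzw : G.Adj z w)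
    (hzv : z ≠ v) (hk : c z u = d z w) : ∃ c' d', SEPair G c' d' := by
  classical
  have hvu : v ≠ u := ((hv u).2 (.inl rfl)).ne
  have hvw : v ≠ w := ((hv w).2 (.inr rfl)).ne
  have hzu' := hzu.ne
  have hzw' := hzw.ne
  have hv' : ∀ t, G.Adj t v ↔ t = u ∨ t = w := fun t => by rw [G.adj_comm, hv]
  have Huz : H.Adj u z := (hH _ _).2 ⟨hzu.symm, hvu.symm, hzv⟩
  have Hwz : H.Adj w z := (hH _ _).2 ⟨hzw.symm, hvw.symm, hzv⟩
  have e1 := h.symm_left z u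
  have e2 := h.symm_right z w
  refine ⟨fun p q => if (p = u ∧ q = v) ∨ (p = v ∧ q = u) then c z u + 1 else
      if (p = w ∧ q = v) ∨ (p = v ∧ q = w) ∨ (p = u ∧ q = z) ∨ (p = z ∧ q = u) then 0 else
        c p q + 1,
    fun p q => if (p = w ∧ q = v) ∨ (p = v ∧ q = w) then c z u + 1 else
      if (p = u ∧ q = v) ∨ (p = v ∧ q = u) ∨ (p = w ∧ q = z) ∨ (p = z ∧ q = w) then 0 else
        d p q + 1, ?_, ?_, ?_, ?_, ?_, ?_, ?_⟩
  · intro p q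
    have := h.symm_left p q
    grind
  · intro p q
    have := h.symm_right p q
    grind
  · intro p x y hx hy e
    have := hv' p
    have := hv x
    have := hv y
    have := h.inj_left p x y
    have := h.inj_left p x z
    have := h.inj_left p y z
    have := h.inj_left p x u
    have := h.inj_left p y u
    grind (splits := 25)
  · intro p x y hx hy e
    have := hv' p
    have := hv x
    have := hv y
    have := h.inj_right p x y
    have := h.inj_right p x z
    have := h.inj_right p y z
    have := h.inj_right p x w
    have := h.inj_right p y w
    grind (splits := 25)
  · intro p x hx
    have := h.exists_right p x
    have := h.exists_right u z
    have := h.inj_left z x u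
    have := hzu.symm
    have := hzw.symm
    by_contra! hno
    have := hno u
    have := hno v
    have := hno w
    have := hno z
    grind
  · intro p x hx
    have := h.exists_left p x
    have := h.exists_left w z
    have := h.inj_right z x w
    have := hzu.symm
    have := hzw.symm
    by_contra! hno
    have := hno u
    have := hno v
    have := hno w
    have := hno z
    grind
  · intro p x hx
    have := h.ne p x
    grind

/-- A coloring of the graph in which the path `w v u y` is replaced by the edge `wy` yields a
coloring of `G`. -/
theorem exists_sePair_of_suppress {V : Type*} {G H : SimpleGraph V} {u v w y : V} {c d : V → V → ℕ}
    (h : SEPair H c d)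
    (hH : ∀ a b, H.Adj a b ↔ (G.Adj a b ∧ a ≠ u ∧ a ≠ v ∧ b ≠ u ∧ b ≠ v) ∨ (a = w ∧ b = y) ∨
      (a = y ∧ b = w))
    (hv : ∀ t, G.Adj v t ↔ t = u ∨ t = w) (hu : ∀ t, G.Adj u t ↔ t = v ∨ t = y)
    (huw : u ≠ w) (hvy : v ≠ y) (hwy : ¬ G.Adj w y) : ∃ c' d', SEPair G c' d' := by
  classical
  have hvu : v ≠ u := ((hv u).2 (.inl rfl)).ne
  have hvw : v ≠ w := ((hv w).2 (.inr rfl)).ne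
  have huy : u ≠ y := ((hu y).2 (.inr rfl)).ne
  have hv' : ∀ t, G.Adj t v ↔ t = u ∨ t = w := fun t => by rw [G.adj_comm, hv]
  have hu' : ∀ t, G.Adj t u ↔ t = v ∨ t = y := fun t => by rw [G.adj_comm, hu]
  have Hwy : H.Adj w y := (hH _ _).2 (by simp)
  have Hyw : H.Adj y w := Hwy.symm
  have hwy' : ¬ G.Adj y w := fun h => hwy h.symm
  have e1 := h.symm_left w y
  have e2 := h.symm_right w y
  have e3 := h.ne w y Hwy
  have nwy : w ≠ y := Hwy.ne
  refine ⟨fun p q => if (p = v ∧ q = u) ∨ (p = u ∧ q = v) then d w y else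
      if (p = w ∧ q = v) ∨ (p = v ∧ q = w) ∨ (p = u ∧ q = y) ∨ (p = y ∧ q = u) then c w y else
        c p q,
    fun p q => if (p = v ∧ q = u) ∨ (p = u ∧ q = v) then c w y else
      if (p = w ∧ q = v) ∨ (p = v ∧ q = w) ∨ (p = u ∧ q = y) ∨ (p = y ∧ q = u) then d w y else
        d p q, ?_, ?_, ?_, ?_, ?_, ?_, ?_⟩
  · intro p q
    have := h.symm_left p q
    grind
  · intro p q
    have := h.symm_right p q
    grind
  · intro p x z hx hz e
    have hpv := hv' p
    have hpu := hu' p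
    have := h.inj_left p x z
    have := h.inj_left p x w
    have := h.inj_left p z w
    have := h.inj_left p x y
    have := h.inj_left p z y
    by_cases h1 : p = v
    · subst h1; rw [hv] at hx hz; grind
    by_cases h2 : p = u
    · subst h2; rw [hu] at hx hz; grind
    have hpx := hH p x
    have hpz := hH p z
    clear hH hv hu hv' hu'
    grind (splits := 25)
  · intro p x z hx hz e
    have hpv := hv' p
    have hpu := hu' p
    have := h.inj_right p x z
    have := h.inj_right p x w
    have := h.inj_right p z w
    have := h.inj_right p x y
    have := h.inj_right p z y
    by_cases h1 : p = v
    · subst h1; rw [hv] at hx hz; grind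
    by_cases h2 : p = u
    · subst h2; rw [hu] at hx hz; grind
    have hpx := hH p x
    have hpz := hH p z
    clear hH hv hu hv' hu'
    grind (splits := 25)
  · intro p x hx
    have := h.exists_right p x
    have := h.exists_right w y
    have := h.exists_right y w
    by_contra! hno
    have := hno u
    have := hno v
    have := hno w
    have := hno y
    grind (splits := 20)
  · intro p x hx
    have := h.exists_left p x
    have := h.exists_left w y
    have := h.exists_left y w
    by_contra! hno
    have := hno u
    have := hno v
    have := hno w
    have := hno y
    grind (splits := 20)
  · intro p x hx
    have := h.ne p x
    grind

/-- A coloring extends to a path `w v u y` between two adjacent vertices. -/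
theorem exists_sePair_of_delete_path {V : Type*} {G H : SimpleGraph V} {u v w y : V}
    {c d : V → V → ℕ} (h : SEPair H c d)
    (hH : ∀ a b, H.Adj a b ↔ G.Adj a b ∧ a ≠ u ∧ a ≠ v ∧ b ≠ u ∧ b ≠ v)
    (hv : ∀ t, G.Adj v t ↔ t = u ∨ t = w) (hu : ∀ t, G.Adj u t ↔ t = v ∨ t = y)
    (huw : u ≠ w) (hvy : v ≠ y) (hwy : G.Adj w y) : ∃ c' d', SEPair G c' d' := by
  classical
  have hvu : v ≠ u := ((hv u).2 (.inl rfl)).ne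
  have hvw : v ≠ w := ((hv w).2 (.inr rfl)).ne
  have huy : u ≠ y := ((hu y).2 (.inr rfl)).ne
  have hv' : ∀ t, G.Adj t v ↔ t = u ∨ t = w := fun t => by rw [G.adj_comm, hv]
  have hu' : ∀ t, G.Adj t u ↔ t = v ∨ t = y := fun t => by rw [G.adj_comm, hu]
  have Hwy : H.Adj w y := (hH _ _).2 ⟨hwy, huw.symm, hvw.symm, huy.symm, hvy.symm⟩
  have Hyw : H.Adj y w := Hwy.symm
  have hwy' : G.Adj y w := hwy.symm
  have e1 := h.symm_left w y
  have nwy : w ≠ y := Hwy.ne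
  refine ⟨fun p q => if (p = v ∧ q = u) ∨ (p = u ∧ q = v) ∨ (p = w ∧ q = y) ∨ (p = y ∧ q = w)
      then 0 else
      if (p = w ∧ q = v) ∨ (p = v ∧ q = w) ∨ (p = u ∧ q = y) ∨ (p = y ∧ q = u) then c w y + 1 else
        c p q + 1,
    fun p q => if (p = v ∧ q = u) ∨ (p = u ∧ q = v) then c w y + 1 else
      if (p = w ∧ q = v) ∨ (p = v ∧ q = w) ∨ (p = u ∧ q = y) ∨ (p = y ∧ q = u) then 0 else
        d p q + 1, ?_, ?_, ?_, ?_, ?_, ?_, ?_⟩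
  · intro p q
    have := h.symm_left p q
    grind
  · intro p q
    have := h.symm_right p q
    grind
  · intro p x z hx hz e
    have hpv := hv' p
    have hpu := hu' p
    have := h.inj_left p x z
    have := h.inj_left p x w
    have := h.inj_left p z w
    have := h.inj_left p x y
    have := h.inj_left p z y
    by_cases h1 : p = v
    · subst h1; rw [hv] at hx hz; grind
    by_cases h2 : p = u
    · subst h2; rw [hu] at hx hz; grind
    have hpx := hH p x
    have hpz := hH p z
    clear hH hv hu hv' hu'
    grind (splits := 25)
  · intro p x z hx hz e
    have hpv := hv' p
    have hpu := hu' p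
    have := h.inj_right p x z
    by_cases h1 : p = v
    · subst h1; rw [hv] at hx hz; grind
    by_cases h2 : p = u
    · subst h2; rw [hu] at hx hz; grind
    have hpx := hH p x
    have hpz := hH p z
    clear hH hv hu hv' hu'
    grind (splits := 25)
  · intro p x hx
    have := h.exists_right p x
    have := h.exists_right w y
    have := h.exists_right y w
    by_contra! hno
    have := hno u
    have := hno v
    have := hno w
    have := hno y
    grind (splits := 20)
  · intro p x hx
    have := h.exists_left p x
    by_contra! hno
    have := hno u
    have := hno v
    have := hno w
    have := hno y
    grind (splits := 20)
  · intro p x hx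
    have := h.ne p x
    grind

theorem exists_sePair_of_square {V : Type*} {G : SimpleGraph V} {u v w y : V}
    (hV : ∀ t, t = u ∨ t = v ∨ t = w ∨ t = y)
    (hv : ∀ t, G.Adj v t ↔ t = u ∨ t = w) (hu : ∀ t, G.Adj u t ↔ t = v ∨ t = y)
    (hw : G.Adj w y) (huw : u ≠ w) (hvy : v ≠ y) : ∃ c d, SEPair G c d := by
  classical
  have hvu : v ≠ u := ((hv u).2 (.inl rfl)).ne
  have hvw : v ≠ w := ((hv w).2 (.inr rfl)).ne
  have huy : u ≠ y := ((hu y).2 (.inr rfl)).ne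
  have hv' : ∀ t, G.Adj t v ↔ t = u ∨ t = w := fun t => by rw [G.adj_comm, hv]
  have hu' : ∀ t, G.Adj t u ↔ t = v ∨ t = y := fun t => by rw [G.adj_comm, hu]
  have hwy' : G.Adj y w := hw.symm
  have nwy : w ≠ y := hw.ne
  refine ⟨fun p q => if (p = w ∨ p = v) ↔ (q = w ∨ q = v) then 0 else 1,
    fun p q => if (p = w ∨ p = v) ↔ (q = w ∨ q = v) then 1 else 0, ?_, ?_, ?_, ?_, ?_, ?_, ?_⟩
  · grind
  · grind
  · intro p x z hx hz e
    have := hV p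
    have := hV x
    have := hV z
    have := hx.ne
    have := hz.ne
    grind
  · intro p x z hx hz e
    have := hV p
    have := hV x
    have := hV z
    have := hx.ne
    have := hz.ne
    grind
  · intro p x hx
    have := hV p
    have := hV x
    have := hx.ne
    by_contra! hno
    have := hno u
    have := hno v
    have := hno w
    have := hno y
    grind
  · intro p x hx
    have := hV p
    have := hV x
    have := hx.ne
    by_contra! hno
    have := hno u
    have := hno v
    have := hno w
    have := hno y
    grind
  · grind

/-- A pair of colorings which around each vertex looks like a `2`-simultaneous edge coloring of
some graph is a `2`-simultaneous edge coloring. -/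
theorem SEPair.of_local {V : Type*} {G : SimpleGraph V} {c d : V → V → ℕ}
    (hc : ∀ x y, c x y = c y x) (hd : ∀ x y, d x y = d y x)
    (hloc : ∀ p, ∃ (H : SimpleGraph V) (c' d' : V → V → ℕ) (φ : ℕ → ℕ) (t : V → V),
      SEPair H c' d' ∧ Function.Injective φ ∧ (∀ q, G.Adj p q → H.Adj p (t q)) ∧
      (∀ q q', G.Adj p q → G.Adj p q' → t q = t q' → q = q') ∧
      (∀ q', H.Adj p q' → ∃ q, G.Adj p q ∧ t q = q') ∧
      (∀ q, G.Adj p q → c p q = φ (c' p (t q))) ∧ ∀ q, G.Adj p q → d p q = φ (d' p (t q))) :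
    SEPair G c d := by
  refine ⟨hc, hd, ?_, ?_, ?_, ?_, ?_⟩
  · intro p x y hx hy e
    obtain ⟨H, c', d', φ, t, h, hφ, ht, hi, hs, hcc, hdd⟩ := hloc p
    rw [hcc x hx, hcc y hy] at e
    exact hi _ _ hx hy (h.inj_left _ _ _ (ht x hx) (ht y hy) (hφ e))
  · intro p x y hx hy e
    obtain ⟨H, c', d', φ, t, h, hφ, ht, hi, hs, hcc, hdd⟩ := hloc p
    rw [hdd x hx, hdd y hy] at e
    exact hi _ _ hx hy (h.inj_right _ _ _ (ht x hx) (ht y hy) (hφ e))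
  · intro p x hx
    obtain ⟨H, c', d', φ, t, h, hφ, ht, hi, hs, hcc, hdd⟩ := hloc p
    obtain ⟨y', hy', e⟩ := h.exists_right _ _ (ht x hx)
    obtain ⟨y, hy, rfl⟩ := hs y' hy'
    exact ⟨y, hy, by rw [hcc x hx, hdd y hy, e]⟩
  · intro p x hx
    obtain ⟨H, c', d', φ, t, h, hφ, ht, hi, hs, hcc, hdd⟩ := hloc p
    obtain ⟨y', hy', e⟩ := h.exists_left _ _ (ht x hx)
    obtain ⟨y, hy, rfl⟩ := hs y' hy'
    exact ⟨y, hy, by rw [hcc y hy, hdd x hx, e]⟩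
  · intro p x hx
    obtain ⟨H, c', d', φ, t, h, hφ, ht, hi, hs, hcc, hdd⟩ := hloc p
    rw [hcc x hx, hdd x hx]
    exact fun e => h.ne _ _ (ht x hx) (hφ e)

/-- At a vertex of degree two the two colorings are interchanged. -/
theorem SEPair.left_eq_right {V : Type*} {G : SimpleGraph V} {c d : V → V → ℕ} (h : SEPair G c d)
    {v a b : V} (ha : G.Adj v a) (hv : ∀ t, G.Adj v t → t = a ∨ t = b) : c v a = d v b := by
  obtain ⟨y, hy, e⟩ := h.exists_right v a ha
  rcases hv y hy with rfl | rfl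
  · exact absurd e.symm (h.ne v y ha)
  · exact e.symm

/-- If exactly the edges `uv` and `xy` leave `X`, colorings of the graphs obtained by contracting
the complement of `X` to `v` and `X` to `u` can be glued to a coloring of `G`. -/
theorem exists_sePair_of_glue {V : Type*} {G H₁ H₂ : SimpleGraph V} {X : Set V} {u v w x y : V}
    {c₁ d₁ c₂ d₂ : V → V → ℕ} (h₁ : SEPair H₁ c₁ d₁) (h₂ : SEPair H₂ c₂ d₂)
    (hv : ∀ t, G.Adj v t ↔ t = u ∨ t = w) (huX : u ∈ X) (hxX : x ∈ X) (hvX : v ∉ X) (hwX : w ∉ X)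
    (hyX : y ∉ X) (hyv : y ≠ v) (hux : u ≠ x)
    (hX : ∀ a b, a ∈ X → b ∉ X → (G.Adj a b ↔ (a = u ∧ b = v) ∨ (a = x ∧ b = y)))
    (hH₁ : ∀ a b, a ∈ X → b ∈ X → (H₁.Adj a b ↔ G.Adj a b))
    (hH₁' : ∀ a b, b ∉ X → (H₁.Adj a b ↔ b = v ∧ (a = u ∨ a = x)))
    (hH₂ : ∀ a b, a ∉ X → b ∉ X → (H₂.Adj a b ↔ G.Adj a b))
    (hH₂' : ∀ a b, a ∈ X → (H₂.Adj a b ↔ a = u ∧ (b = v ∨ b = y))) :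
    ∃ c d, SEPair G c d := by
  classical
  have hvx : H₁.Adj x v := (hH₁' _ _ hvX).2 (by simp)
  have huv₁ : H₁.Adj u v := (hH₁' _ _ hvX).2 (by simp)
  have huv₂ : H₂.Adj u v := (hH₂' _ _ huX).2 (by simp)
  have huy : H₂.Adj u y := (hH₂' _ _ huX).2 (by simp)
  have hvw : H₂.Adj v w := (hH₂ _ _ hvX hwX).2 ((hv w).2 (.inr rfl))
  have nv₁ : ∀ t, H₁.Adj v t → t = u ∨ t = x := fun t ht => ((hH₁' _ _ hvX).1 ht.symm).2
  have nu₂ : ∀ t, H₂.Adj u t → t = v ∨ t = y := fun t ht => ((hH₂' _ _ huX).1 ht).2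
  have nv₂ : ∀ t, H₂.Adj v t → t = u ∨ t = w := fun t ht => by
    by_cases htX : t ∈ X
    · exact .inl ((hH₂' _ _ htX).1 ht.symm).1
    · exact (hv t).1 ((hH₂ _ _ hvX htX).1 ht)
  have e₁ := h₁.left_eq_right huv₁.symm nv₁
  have e₂ := h₁.left_eq_right hvx.symm fun t ht => (nv₁ t ht).symm
  have e₃ := h₂.left_eq_right huv₂.symm nv₂
  have e₄ := h₂.left_eq_right hvw fun t ht => (nv₂ t ht).symm
  have e₅ := h₂.left_eq_right huv₂ nu₂
  have e₆ := h₂.left_eq_right huy fun t ht => (nu₂ t ht).symm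
  have ne₁ := h₁.ne _ _ huv₁.symm
  have ne₂ := h₂.ne _ _ huv₂.symm
  have s₁ := h₁.symm_left v u
  have s₂ := h₁.symm_right v u
  have s₃ := h₁.symm_left v x
  have s₄ := h₁.symm_right v x
  have s₅ := h₂.symm_left v u
  have s₆ := h₂.symm_right v u
  have s₇ := h₂.symm_left u y
  have s₈ := h₂.symm_right u y
  obtain ⟨k, hk⟩ : ∃ k, k = c₁ v u := ⟨_, rfl⟩
  obtain ⟨l, hl⟩ : ∃ l, l = d₁ v u := ⟨_, rfl⟩
  obtain ⟨k', hk'⟩ : ∃ k, k = d₂ v u := ⟨_, rfl⟩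
  obtain ⟨l', hl'⟩ : ∃ l, l = c₂ v u := ⟨_, rfl⟩
  have hkl : k ≠ l := by grind
  have hkl' : k' ≠ l' := by grind
  let φ : ℕ → ℕ := fun n => if n = k' then 2 * l else if n = l' then 2 * k else 2 * n + 1
  have hφ : Function.Injective φ := by
    intro m n e
    simp only [φ] at e
    grind
  have φk : φ k' = 2 * l := by simp [φ]
  have φl : φ l' = 2 * k := by simp [φ, hkl'.symm]
  refine ⟨fun p q => if p ∈ X ∧ q ∈ X then 2 * c₁ p q else if p ∉ X ∧ q ∉ X then φ (c₂ p q) else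
      if p = v ∨ q = v then 2 * k else 2 * l,
    fun p q => if p ∈ X ∧ q ∈ X then 2 * d₁ p q else if p ∉ X ∧ q ∉ X then φ (d₂ p q) else
      if p = v ∨ q = v then 2 * l else 2 * k, SEPair.of_local ?_ ?_ fun p => ?_⟩
  · intro p q
    have := h₁.symm_left p q
    have := h₂.symm_left p q
    grind
  · intro p q
    have := h₁.symm_right p q
    have := h₂.symm_right p q
    grind
  · clear_value φ
    by_cases hp : p ∈ X
    · refine ⟨H₁, c₁, d₁, fun n => 2 * n, fun q => if q ∈ X then q else v, h₁,
        fun m n (e : 2 * m = 2 * n) => by omega, ?_, ?_, ?_, ?_, ?_⟩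
      · intro q hq
        have := hX p q hp
        grind
      · intro q q' hq hq'
        have := hX p q hp
        have := hX p q' hp
        grind
      · intro q' hq'
        by_cases hq'X : q' ∈ X
        · exact ⟨q', (hH₁ _ _ hp hq'X).1 hq', by simp [hq'X]⟩
        · obtain ⟨rfl, h⟩ := (hH₁' _ _ hq'X).1 hq'
          rcases h with rfl | rfl
          · exact ⟨q', (hX _ _ hp hq'X).2 (by simp), by simp [hq'X]⟩
          · exact ⟨y, (hX _ _ hp hyX).2 (by simp), by simp [hyX]⟩
      · intro q hq
        have := hX p q hp
        grind
      · intro q hq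
        have := hX p q hp
        grind
    · refine ⟨H₂, c₂, d₂, φ, fun q => if q ∈ X then u else q, h₂, hφ, ?_, ?_, ?_, ?_, ?_⟩
      · intro q hq
        by_cases hqX : q ∈ X
        · rcases (hX _ _ hqX hp).1 hq.symm with ⟨rfl, rfl⟩ | ⟨rfl, rfl⟩
          · simpa [hqX] using huv₂.symm
          · simpa [hqX] using huy.symm
        · simpa [hqX] using (hH₂ _ _ hp hqX).2 hq
      · intro q q' hq hq'
        have := hX q p
        have := hX q' p
        have := hq.symm
        have := hq'.symm
        grind
      · intro q' hq'
        by_cases hq'X : q' ∈ X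
        · obtain ⟨rfl, h⟩ := (hH₂' _ _ hq'X).1 hq'.symm
          rcases h with rfl | rfl
          · exact ⟨q', ((hX _ _ hq'X hp).2 (by simp)).symm, by simp [hq'X]⟩
          · exact ⟨x, ((hX _ _ hxX hp).2 (by simp)).symm, by simp [hxX]⟩
        · exact ⟨q', (hH₂ _ _ hp hq'X).1 hq', by simp [hq'X]⟩
      · intro q hq
        have := hX q p
        have := hq.symm
        grind
      · intro q hq
        have := hX q p
        have := hq.symm
        grind

namespace IsExtremal

variable {V : Type} [Finite V] {G : SimpleGraph V}

theorem exists_sePair_contraction_cut (hG : IsExtremal G) {X : Set V} {u v w x y : V} {s : V → Prop}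
    (hs : ∀ a b, G.Adj a b → (s b ↔ ¬ s a)) (hux : u ≠ x) (hsux : s u ↔ s x)
    (hv : ∀ t, G.Adj v t ↔ t = u ∨ t = w) (huX : u ∈ X) (hxX : x ∈ X) (hvX : v ∉ X) (hwX : w ∉ X)
    (hyX : y ∉ X) (hyv : y ≠ v)
    (hX : ∀ a b, a ∈ X → b ∉ X → (G.Adj a b ↔ (a = u ∧ b = v) ∨ (a = x ∧ b = y))) : False := by
  classical
  have huv : G.Adj v u := (hv _).2 (.inl rfl)
  have hvw : G.Adj v w := (hv _).2 (.inr rfl)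
  have hxy : G.Adj x y := (hX _ _ hxX hyX).2 (by simp)
  have hsv := hs _ _ huv
  have hsy := hs _ _ hxy
  obtain ⟨n, hn, hnX⟩ : ∃ n, G.Adj x n ∧ n ∈ X := by
    obtain ⟨a, b, a', b', ha, hb, hab, ha', hb', hab', hne⟩ := hG.cross {x} ⟨x, rfl⟩ ⟨u, hux⟩
    rw [Set.mem_singleton_iff] at ha ha'
    subst ha ha'
    by_contra! hno
    have := hno b hab
    have := hno b' hab'
    grind
  obtain ⟨c₁, d₁, h₁⟩ := hG.exists_sePair_contraction (fun a => if a ∈ X then a else v) (s := s)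
    (fun a b hab hr => by
      have := hs a b hab
      have := hX a b
      have := hX b a
      have := hab.symm
      grind)
    (fun a b a' b' hab hab' hr => by
      have := hX a b
      have := hX b a
      have := hX a' b'
      have := hX b' a'
      have := hab.symm
      have := hab'.symm
      grind) ⟨v, w, hvw, by simp [hvX, hwX]⟩
  obtain ⟨c₂, d₂, h₂⟩ := hG.exists_sePair_contraction (fun a => if a ∈ X then u else a) (s := s)
    (fun a b hab hr => by
      have := hs a b hab
      have := hX a b
      have := hX b a
      have := hab.symm
      grind)
    (fun a b a' b' hab hab' hr => by
      have := hX a b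
      have := hX b a
      have := hX a' b'
      have := hX b' a'
      have := hab.symm
      have := hab'.symm
      grind) ⟨x, n, hn, by simp [hxX, hnX]⟩
  refine hG.not_sePair (exists_sePair_of_glue h₁ h₂ hv huX hxX hvX hwX hyX hyv hux hX ?_ ?_ ?_ ?_)
  · intro a b ha hb
    constructor
    · rintro ⟨hne, p, q, hpq, hp, hq⟩
      grind
    · intro hab
      exact ⟨hab.ne, a, b, hab, by grind, by grind⟩
  · intro a b hb
    constructor
    · rintro ⟨hne, p, q, hpq, hp, hq⟩
      have := hX p q
      grind
    · rintro ⟨rfl, h | h⟩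
      · exact ⟨by grind, u, b, huv.symm, by grind, by grind⟩
      · exact ⟨by grind, x, y, hxy, by grind, by grind⟩
  · intro a b ha hb
    constructor
    · rintro ⟨hne, p, q, hpq, hp, hq⟩
      grind
    · intro hab
      exact ⟨hab.ne, a, b, hab, by grind, by grind⟩
  · intro a b ha
    constructor
    · rintro ⟨hne, p, q, hpq, hp, hq⟩
      have := hX p q
      grind
    · rintro ⟨rfl, h | h⟩
      · exact ⟨by grind, a, v, huv.symm, by grind, by grind⟩
      · exact ⟨by grind, x, y, hxy, by grind, by grind⟩

theorem false_of_adj_degree_two (hG : IsExtremal G) {u v w y : V}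
    (hv : ∀ t, G.Adj v t ↔ t = u ∨ t = w) (hu : ∀ t, G.Adj u t ↔ t = v ∨ t = y)
    (huw : u ≠ w) (hvy : v ≠ y) : False := by
  classical
  obtain ⟨s, hs⟩ := hG.side
  have hvu : G.Adj v u := (hv u).2 (.inl rfl)
  have hvw : G.Adj v w := (hv w).2 (.inr rfl)
  have huy : G.Adj u y := (hu y).2 (.inr rfl)
  have hv' : ∀ t, G.Adj t v ↔ t = u ∨ t = w := fun t => by rw [G.adj_comm, hv]
  have hu' : ∀ t, G.Adj t u ↔ t = v ∨ t = y := fun t => by rw [G.adj_comm, hu]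
  have hsu := hs _ _ hvu
  have hsw := hs _ _ hvw
  have hsy := hs _ _ huy
  have nwy : w ≠ y := by rintro rfl; tauto
  have := hvu.ne
  have := hvw.ne
  have := huy.ne
  by_cases hwy : G.Adj w y
  · have hH : ∀ a b, ((G.deleteIncidenceSet u).deleteIncidenceSet v).Adj a b ↔
        G.Adj a b ∧ a ≠ u ∧ a ≠ v ∧ b ≠ u ∧ b ≠ v := fun a b => by
      simp only [deleteIncidenceSet_adj]
      tauto
    generalize (G.deleteIncidenceSet u).deleteIncidenceSet v = H at hH
    by_cases hcut : ∀ S : Set V, w ∈ S → y ∉ S → TwoCross H S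
    · obtain ⟨c, d, h⟩ := hG.exists_sePair_of_support H {t | t ≠ u ∧ t ≠ v} ⟨w, huw.symm, hvw.ne'⟩
        (fun a b hab => by have := (hH a b).1 hab; grind) (by
          rintro S ⟨p, hp, hpS⟩ ⟨q, hq, hqS⟩
          by_cases hsep : w ∈ S ↔ y ∈ S
          · obtain ⟨a, b, a', b', ha, hb, hab, ha', hb', hab', hne⟩ := hG.cross
              {t | (t ∈ S ∧ t ≠ u ∧ t ≠ v) ∨ (w ∈ S ∧ (t = u ∨ t = v))} ⟨p, .inl ⟨hpS, hp⟩⟩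
              ⟨q, by simp only [Set.mem_compl_iff, Set.mem_ofPred_eq] at hq ⊢; tauto⟩
            simp only [Set.mem_ofPred_eq] at ha hb ha' hb'
            have := hv a
            have := hv' a
            have := hv' a'
            have := hu' a
            have := hu' a'
            have := hv b
            have := hv b'
            have := hu b
            have := hu b'
            exact ⟨a, b, a', b', by grind, by grind, by grind, by grind, by grind, by grind, hne⟩
          · by_cases hwS : w ∈ S
            · exact hcut S hwS (by tauto)
            · exact (hcut Sᶜ hwS (by simp only [Set.mem_compl_iff]; tauto)).of_compl)
        ⟨s, fun a b hab => hs a b ((hH a b).1 hab).1⟩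
        (Set.ncard_lt_ncard (edgeSet_ssubset_edgeSet.2 (lt_of_le_of_ne
          (fun a b hab => ((hH a b).1 hab).1)
          (fun e => ((hH v u).1 (e ▸ hvu)).2.2.1 rfl))) (Set.toFinite _))
      exact hG.not_sePair (exists_sePair_of_delete_path h hH hv hu huw hvy hwy)
    · push Not at hcut
      obtain ⟨S, hwS, hyS, hS⟩ := hcut
      have Hwy : H.Adj w y := (hH w y).2 ⟨hwy, by grind⟩
      have huniq : ∀ a b, a ∈ S → b ∉ S → H.Adj a b → a = w ∧ b = y := by
        intro a b ha hb hab
        by_contra hne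
        exact hS ⟨a, b, w, y, ha, hb, hab, hwS, hyS, Hwy, by tauto⟩
      refine hG.not_sePair (exists_sePair_of_square (fun t => ?_) hv hu hwy huw hvy)
      by_contra! ht
      by_cases htS : t ∈ S
      · obtain ⟨a, b, ha, hb, hbw, hab⟩ := hG.exists_adj_of_notMem (z := w)
          (A := {t | t ∈ S ∧ t ≠ w ∧ t ≠ u ∧ t ≠ v}) (by simp) ⟨t, by simp [htS, ht]⟩ (y := y)
          (by simp [hyS]) nwy.symm
        simp only [Set.mem_ofPred_eq] at ha hb
        have := huniq a b
        have := hv' a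
        have := hu' a
        grind
      · obtain ⟨a, b, ha, hb, hbw, hab⟩ := hG.exists_adj_of_notMem (z := y)
          (A := {t | t ∉ S ∧ t ≠ y ∧ t ≠ u ∧ t ≠ v}) (by simp) ⟨t, by simp [htS, ht]⟩ (y := w)
          (by simp [hwS]) nwy
        simp only [Set.mem_ofPred_eq] at ha hb
        have := huniq b a
        have := hv' a
        have := hu' a
        have := hab.symm
        grind
  · have key : ∀ a b, G.Adj a b →
        (if a = u ∨ a = v then y else a) ≠ (if b = u ∨ b = v then y else b) →
        (a ≠ u ∧ a ≠ v ∧ b ≠ u ∧ b ≠ v) ∨ (a = w ∧ b = v) ∨ (a = v ∧ b = w) := by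
      intro a b hab hr
      have := hv' a
      have := hv' b
      have := hu' a
      have := hu' b
      have := hab.symm
      grind
    obtain ⟨c, d, h⟩ := hG.exists_sePair_contraction (fun a => if a = u ∨ a = v then y else a)
      (s := s)
      (fun a b hab hr => by
        have := hs a b hab
        have := key a b hab hr
        grind)
      (fun a b a' b' hab hab' hr h1 h2 => by
        have k := key a b hab hr
        have k' := key a' b' hab' (by rw [← h1, ← h2]; exact hr)
        have := fun h : G.Adj y w => hwy h.symm
        clear hv hu hv' hu' key
        grind) ⟨v, u, hvu, by simp⟩
    refine hG.not_sePair (exists_sePair_of_suppress h (fun a b => ?_) hv hu huw hvy hwy)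
    constructor
    · rintro ⟨hne, p, q, hpq, rfl, rfl⟩
      have := hv' p
      have := hv' q
      have := hu' p
      have := hu' q
      have := hpq.symm
      grind
    · rintro (⟨hab, h1, h2, h3, h4⟩ | ⟨rfl, rfl⟩ | ⟨rfl, rfl⟩)
      · exact ⟨hab.ne, a, b, hab, by grind, by grind⟩
      · exact ⟨nwy, a, v, hvw.symm, by grind, by grind⟩
      · exact ⟨nwy.symm, v, b, hvw, by grind, by grind⟩

end IsExtremal

namespace IsExtremal

variable {V : Type} [Finite V] {G : SimpleGraph V}

theorem false_of_cut (hG : IsExtremal G) {X : Set V} {u v w x y : V} {s : V → Prop}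
    (hs : ∀ a b, G.Adj a b → (s b ↔ ¬ s a)) (hsux : s u ↔ s x)
    (hv : ∀ t, G.Adj v t ↔ t = u ∨ t = w) (huX : u ∈ X) (hxX : x ∈ X) (hvX : v ∉ X) (hwX : w ∉ X)
    (hyX : y ∉ X) (hyv : y ≠ v)
    (hX : ∀ a b, a ∈ X → b ∉ X → (G.Adj a b ↔ (a = u ∧ b = v) ∨ (a = x ∧ b = y))) : False := by
  rcases eq_or_ne u x with rfl | hux
  · have hXu : ∀ t, t ∈ X → t = u := by
      by_contra! hno
      obtain ⟨t, htX, htu⟩ := hno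
      obtain ⟨a, b, ha, hb, hbu, hab⟩ := hG.exists_adj_of_notMem (z := u) (A := X \ {u}) (by simp)
        ⟨t, htX, htu⟩ (y := y) (fun h => hyX h.1) (fun h => hyX (h ▸ huX))
      have := hX a b ha.1 fun h => hb ⟨h, hbu⟩
      exact ha.2 (by simp only [Set.mem_singleton_iff]; tauto)
    refine hG.false_of_adj_degree_two hv (fun t => ?_) (fun h => hwX (h ▸ huX)) hyv.symm
    by_cases htX : t ∈ X
    · have := hXu t htX
      subst this
      have : ¬ G.Adj t t := G.irrefl
      grind
    · rw [hX u t huX htX]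
      simp
  · exact hG.exists_sePair_contraction_cut hs hux hsux hv huX hxX hvX hwX hyX hyv hX

theorem twoCross_deleteIncidenceSet (hG : IsExtremal G) {u v w : V}
    (hv : ∀ t, G.Adj v t ↔ t = u ∨ t = w) {S : Set V} {p q : V} (hp : p ≠ v) (hpS : p ∈ S)
    (hq : q ≠ v) (hqS : q ∉ S) : TwoCross (G.deleteIncidenceSet v) S := by
  obtain ⟨s, hs⟩ := hG.side
  have main : ∀ (u w : V), (∀ t, G.Adj v t ↔ t = u ∨ t = w) → ∀ (X : Set V) (x y : V), u ∈ X →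
      x ∈ X → v ∉ X → w ∉ X → y ∉ X → y ≠ v → G.Adj x y →
      (∀ a b, a ∈ X → b ∉ X → b ≠ v → G.Adj a b → a = x ∧ b = y) → False := by
    intro u w hv X x y huX hxX hvX hwX hyX hyv hxy huniq
    have hvu := (hv u).2 (.inl rfl)
    have hvw := (hv w).2 (.inr rfl)
    have hX : ∀ a b, a ∈ X → b ∉ X → (G.Adj a b ↔ (a = u ∧ b = v) ∨ (a = x ∧ b = y)) := by
      intro a b ha hb
      have := huniq a b ha hb
      have := hv a
      have := G.adj_comm a b
      have := hvu.symm
      grind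
    by_cases hsux : s u ↔ s x
    · exact hG.false_of_cut hs hsux hv huX hxX hvX hwX hyX hyv hX
    · have := hs _ _ hvu
      have := hs _ _ hvw
      have := hs _ _ hxy
      refine hG.false_of_cut (X := {t | t ∉ X ∧ t ≠ v}) (u := w) (w := u) (x := y) (y := x) hs
        (by tauto) (fun t => (hv t).trans or_comm) ⟨hwX, hvw.ne'⟩ ⟨hyX, hyv⟩ (by simp)
        (by simp [huX]) (by simp [hxX]) (fun h => hvX (h ▸ hxX)) ?_
      intro a b ha hb
      simp only [Set.mem_ofPred_eq] at ha hb
      have := hX b a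
      have := hv a
      have := G.adj_comm a b
      have := hvw.symm
      grind
  have key : ∀ (X : Set V) (p q : V), v ∉ X → p ∈ X → q ∉ X → q ≠ v →
      TwoCross (G.deleteIncidenceSet v) X := by
    intro X p q hvX hpX hqX hqv
    obtain ⟨x, y, hxX, hyX, hyv, hxy⟩ := hG.exists_adj_of_notMem hvX ⟨p, hpX⟩ hqX hqv
    by_contra hno
    have huniq : ∀ a b, a ∈ X → b ∉ X → b ≠ v → G.Adj a b → a = x ∧ b = y := by
      intro a b ha hb hbv hab
      by_contra hne
      exact hno ⟨a, b, x, y, ha, hb,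
        (deleteIncidenceSet_adj).2 ⟨hab, fun e => hvX (e ▸ ha), hbv⟩, hxX, hyX,
        (deleteIncidenceSet_adj).2 ⟨hxy, fun e => hvX (e ▸ hxX), hyv⟩, by tauto⟩
    by_cases huX : u ∈ X <;> by_cases hwX : w ∈ X
    · obtain ⟨a, b, a', b', ha, hb, hab, ha', hb', hab', hne⟩ := hG.cross (insert v X)
        ⟨v, by simp⟩ ⟨q, by simp [hqX, hqv]⟩
      simp only [Set.mem_insert_iff] at ha hb ha' hb'
      have := huniq a b
      have := huniq a' b'
      have := hv b
      have := hv b'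
      grind
    · exact main u w hv X x y huX hxX hvX hwX hyX hyv hxy huniq
    · exact main w u (fun t => (hv t).trans or_comm) X x y hwX hxX hvX huX hyX hyv hxy huniq
    · obtain ⟨a, b, a', b', ha, hb, hab, ha', hb', hab', hne⟩ := hG.cross X ⟨p, hpX⟩ ⟨q, hqX⟩
      have hbv : ∀ a b, a ∈ X → G.Adj a b → b ≠ v := by
        rintro a b ha hab rfl
        rcases (hv a).1 hab.symm with rfl | rfl
        · exact huX ha
        · exact hwX ha
      have h1 := huniq a b ha hb (hbv a b ha hab) hab
      have h2 := huniq a' b' ha' hb' (hbv a' b' ha' hab') hab'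
      rw [h1.1, h1.2, h2.1, h2.2] at hne
      simp at hne
  by_cases hvS : v ∈ S
  · exact (key Sᶜ q p (not_not.2 hvS) hqS (not_not.2 hpS) hp).of_compl
  · exact key S p q hvS hpS hqS hq

theorem neighborSet_inter (hG : IsExtremal G) {u v w z : V} (hv : ∀ t, G.Adj v t ↔ t = u ∨ t = w)
    (huw : u ≠ w) (hzu : G.Adj z u) (hzw : G.Adj z w) : z = v := by
  by_contra hzv
  have hvu := (hv u).2 (.inl rfl)
  have hvw := (hv w).2 (.inr rfl)
  obtain ⟨s, hs⟩ := hG.side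
  have hH : ∀ a b, (G.deleteIncidenceSet v).Adj a b ↔ G.Adj a b ∧ a ≠ v ∧ b ≠ v :=
    fun a b => deleteIncidenceSet_adj
  obtain ⟨c, d, h⟩ := hG.exists_sePair_of_support (G.deleteIncidenceSet v) {v}ᶜ ⟨u, hvu.ne'⟩
    (fun a b hab => ((hH a b).1 hab).2.1)
    (fun S ⟨p, hp, hpS⟩ ⟨q, hq, hqS⟩ => hG.twoCross_deleteIncidenceSet hv hp hpS hq hqS)
    ⟨s, fun a b hab => hs a b ((hH a b).1 hab).1⟩
    (Set.ncard_lt_ncard (edgeSet_ssubset_edgeSet.2 (lt_of_le_of_ne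
      (fun a b hab => ((hH a b).1 hab).1)
      (fun e => ((hH v u).1 (by rw [e]; exact hvu)).2.1 rfl))) (Set.toFinite _))
  have Hu : (G.deleteIncidenceSet v).Adj z u := (hH _ _).2 ⟨hzu, hzv, hvu.ne'⟩
  have Hw : (G.deleteIncidenceSet v).Adj z w := (hH _ _).2 ⟨hzw, hzv, hvw.ne'⟩
  have hcd : c z u = d z w ∨ d z u = c z w := by
    obtain ⟨a, ha, hae⟩ := h.exists_right z u Hu
    obtain ⟨b, hb, hbe⟩ := h.exists_right z w Hw
    have := h.ne z u Hu
    have := h.ne z w Hw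
    have := h.inj_left z u w Hu Hw
    have := hG.not_four_adj hzu hzw ((hH _ _).1 ha).1 ((hH _ _).1 hb).1 huw
    grind
  rcases hcd with e | e
  · exact hG.not_sePair (exists_sePair_of_delete h hH hv huw hzu hzw hzv e)
  · exact hG.not_sePair (exists_sePair_of_delete h.swap hH hv huw hzu hzw hzv e)

end IsExtremal

/-- In a counterexample to the strong SE conjecture with the minimum number of edges and,
among those, the maximum number of vertices: for every vertex `v` of degree 2, the graph
`G - v` is bridgeless, and if `N(v) = {u, w}` then `N(u) ∩ N(w) = {v}`. -/
theorem extremal_counterexample_degree_two_vertices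
    {V : Type} [Fintype V] (G : SimpleGraph V)
    (hbridgeless : IsKEdgeConnected G 2) (hbip : G.Colorable 2)
    (hnotSE : ¬ SimultaneousEdgeColorable G 2)
    (hminEdges : ∀ (k : ℕ) (G' : SimpleGraph (Fin k)), IsKEdgeConnected G' 2 →
      G'.Colorable 2 → G'.edgeSet.ncard < G.edgeSet.ncard →
      SimultaneousEdgeColorable G' 2)
    (hmaxVerts : ∀ (k : ℕ) (G' : SimpleGraph (Fin k)), IsKEdgeConnected G' 2 →
      G'.Colorable 2 → G'.edgeSet.ncard = G.edgeSet.ncard → Fintype.card V < k →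
      SimultaneousEdgeColorable G' 2)
    : ∀ v : V, (G.neighborSet v).ncard = 2 →
      IsKEdgeConnected (G.induce ({v}ᶜ : Set V)) 2 ∧
      (∀ u w : V, G.neighborSet v = {u, w} →
        G.neighborSet u ∩ G.neighborSet w = {v}) := by
  obtain ⟨hne, hcross⟩ := (isKEdgeConnected_two_iff G).1 hbridgeless
  have hG : IsExtremal G := by
    refine ⟨hne, hcross, exists_side_of_colorable hbip,
      fun h => hnotSE ((simultaneousEdgeColorable_two_iff G).2 h), ?_, ?_⟩
    · intro W _ _ H hcut hside hlt
      obtain ⟨H', h1, h2, h3, h4⟩ := exists_copy_fin H hcut hside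
      exact h4 (hminEdges _ H' h1 h2 (h3 ▸ hlt))
    · intro W _ _ H hcut hside heq hlt
      obtain ⟨H', h1, h2, h3, h4⟩ := exists_copy_fin H hcut hside
      exact h4 (hmaxVerts _ H' h1 h2 (h3 ▸ heq) (Nat.card_eq_fintype_card (α := V) ▸ hlt))
  intro v hcard
  have hadj : ∀ u w, G.neighborSet v = {u, w} → ∀ t, G.Adj v t ↔ t = u ∨ t = w := by
    intro u w h t
    rw [← mem_neighborSet, h]
    simp
  refine ⟨?_, fun u w h => ?_⟩
  · obtain ⟨u, w, huw, h⟩ := Set.ncard_eq_two.1 hcard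
    have hv := hadj u w h
    rw [isKEdgeConnected_two_iff]
    refine ⟨⟨u, ((hv u).2 (.inl rfl)).ne'⟩, fun S ⟨p, hp⟩ ⟨q, hq⟩ => ?_⟩
    obtain ⟨a, b, a', b', ha, hb, hab, ha', hb', hab', hne'⟩ :=
      hG.twoCross_deleteIncidenceSet hv (S := Subtype.val '' S) p.2 ⟨p, hp, rfl⟩ q.2
        (fun ⟨x, hx, e⟩ => hq (Subtype.ext e ▸ hx))
    obtain ⟨a, ha, rfl⟩ := ha
    obtain ⟨a', ha', rfl⟩ := ha'
    rw [deleteIncidenceSet_adj] at hab hab'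
    exact ⟨a, ⟨b, hab.2.2⟩, a', ⟨b', hab'.2.2⟩, ha, fun h => hb ⟨_, h, rfl⟩, hab.1, ha',
      fun h => hb' ⟨_, h, rfl⟩, hab'.1, by simpa [Subtype.ext_iff] using hne'⟩
  · have hv := hadj u w h
    have huw : u ≠ w := by
      rintro rfl
      simp [h] at hcard
    ext z
    simp only [Set.mem_inter_iff, mem_neighborSet, Set.mem_singleton_iff]
    refine ⟨fun hz => hG.neighborSet_inter hv huw hz.1.symm hz.2.symm, ?_⟩
    rintro rfl
    exact ⟨((hv u).2 (.inl rfl)).symm, ((hv w).2 (.inr rfl)).symm⟩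
end

section
/- Let G be a 2-simultaneous edge colorable graph, let xy be an edge of G, and let k ≥ 1. Let G' be the graph obtained from G by deleting the edge xy and adding 2k new vertices v_1, …, v_{2k} together with the path x v_1 v_2 … v_{2k} y. Then G' is 2-simultaneous edge colorable. -/
open SimpleGraph

/-- The graph obtained from `G` by deleting the edge `xy` and adding `2k` new vertices
`v₁, …, v_{2k}` (here `Sum.inr 0, …, Sum.inr (2k-1)`) together with the path
`x v₁ v₂ … v_{2k} y`. -/
def subdividedGraph {V : Type*} (G : SimpleGraph V) (x y : V) (k : ℕ) :
    SimpleGraph (V ⊕ Fin (2 * k)) :=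
  SimpleGraph.fromRel (fun a b =>
    match a, b with
    | Sum.inl u, Sum.inl v => G.Adj u v ∧ ¬(u = x ∧ v = y) ∧ ¬(u = y ∧ v = x)
    | Sum.inl u, Sum.inr i => (u = x ∧ (i : ℕ) = 0) ∨ (u = y ∧ (i : ℕ) = 2 * k - 1)
    | Sum.inr i, Sum.inr j => (i : ℕ) + 1 = (j : ℕ)
    | Sum.inr _, Sum.inl _ => False)

theorem isProperEdgeColoring_iff_adj {V : Type*} {G : SimpleGraph V} {c : Sym2 V → ℕ} :
    IsProperEdgeColoring G c ↔
      ∀ v u w, G.Adj v u → G.Adj v w → u ≠ w → c s(v, u) ≠ c s(v, w) := by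
  constructor
  · intro h v u w hu hw huw
    exact h _ hu _ hw (fun e => huw (Sym2.congr_right.1 e)) ⟨v, by simp, by simp⟩
  · rintro h e₁ h₁ e₂ h₂ hne ⟨v, hv₁, hv₂⟩
    obtain ⟨u, rfl⟩ := hv₁
    obtain ⟨w, rfl⟩ := hv₂
    exact h v u w h₁ h₂ (fun e => hne (by rw [e]))

theorem mem_colorsAt_iff_adj {V : Type*} {G : SimpleGraph V} {c : Sym2 V → ℕ} {v : V} {n : ℕ} :
    n ∈ colorsAt G c v ↔ ∃ u, G.Adj v u ∧ c s(v, u) = n := by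
  constructor
  · rintro ⟨e, he, ⟨u, rfl⟩, hc⟩
    exact ⟨u, he, hc⟩
  · rintro ⟨u, hu, hc⟩
    exact ⟨s(v, u), hu, by simp, hc⟩

section SubdividedGraph

variable {V : Type*} {G : SimpleGraph V} {x y : V} {k : ℕ}

theorem subdividedGraph_adj_inl_inl {u v : V} :
    (subdividedGraph G x y k).Adj (Sum.inl u) (Sum.inl v) ↔
      G.Adj u v ∧ ¬(u = x ∧ v = y) ∧ ¬(u = y ∧ v = x) := by
  simp only [subdividedGraph, fromRel_adj, ne_eq, Sum.inl.injEq]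
  constructor
  · rintro ⟨-, h | ⟨h, h₁, h₂⟩⟩
    · exact h
    · exact ⟨h.symm, by tauto, by tauto⟩
  · intro h
    exact ⟨h.1.ne, Or.inl h⟩

theorem subdividedGraph_adj_inl_inr {u : V} {i : Fin (2 * k)} :
    (subdividedGraph G x y k).Adj (Sum.inl u) (Sum.inr i) ↔
      (u = x ∧ (i : ℕ) = 0) ∨ (u = y ∧ (i : ℕ) = 2 * k - 1) := by
  simp [subdividedGraph]

theorem subdividedGraph_adj_inr_inl {u : V} {i : Fin (2 * k)} :
    (subdividedGraph G x y k).Adj (Sum.inr i) (Sum.inl u) ↔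
      (u = x ∧ (i : ℕ) = 0) ∨ (u = y ∧ (i : ℕ) = 2 * k - 1) := by
  rw [adj_comm, subdividedGraph_adj_inl_inr]

theorem subdividedGraph_adj_inr_inr {i j : Fin (2 * k)} :
    (subdividedGraph G x y k).Adj (Sum.inr i) (Sum.inr j) ↔
      (i : ℕ) + 1 = j ∨ (j : ℕ) + 1 = i := by
  simp only [subdividedGraph, fromRel_adj, ne_eq, Sum.inr.injEq, Fin.ext_iff]
  omega

/-- The coloring of the subdivided graph that agrees with `c` on the old edges and alternates
the colors `p, q, p, …, q, p` along the new path. -/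
def subdividedColoring (k : ℕ) (c : Sym2 V → ℕ) (p q : ℕ) : Sym2 (V ⊕ Fin (2 * k)) → ℕ :=
  Sym2.lift ⟨fun a b =>
    match a, b with
    | Sum.inl u, Sum.inl v => c s(u, v)
    | Sum.inr i, Sum.inr j => if min (i : ℕ) j % 2 = 0 then q else p
    | _, _ => p, by
      rintro (u | i) (v | j)
      · simp [Sym2.eq_swap]
      · rfl
      · rfl
      · simp [min_comm]⟩

section

variable (c : Sym2 V → ℕ) (p q : ℕ)

@[simp] theorem subdividedColoring_inl_inl (u v : V) :
    subdividedColoring k c p q s(Sum.inl u, Sum.inl v) = c s(u, v) := rfl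

@[simp] theorem subdividedColoring_inl_inr (u : V) (i : Fin (2 * k)) :
    subdividedColoring k c p q s(Sum.inl u, Sum.inr i) = p := rfl

@[simp] theorem subdividedColoring_inr_inl (u : V) (i : Fin (2 * k)) :
    subdividedColoring k c p q s(Sum.inr i, Sum.inl u) = p := rfl

@[simp] theorem subdividedColoring_inr_inr (i j : Fin (2 * k)) :
    subdividedColoring k c p q s(Sum.inr i, Sum.inr j) =
      if min (i : ℕ) j % 2 = 0 then q else p := rfl

end

variable {c : Sym2 V → ℕ} {q : ℕ}

theorem isProperEdgeColoring_subdividedColoring (hxy : G.Adj x y) (hk : 1 ≤ k)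
    (hc : IsProperEdgeColoring G c) (hq : c s(x, y) ≠ q) :
    IsProperEdgeColoring (subdividedGraph G x y k) (subdividedColoring k c (c s(x, y)) q) := by
  rw [isProperEdgeColoring_iff_adj] at hc ⊢
  have old_ne_new : ∀ v u (i : Fin (2 * k)),
      (subdividedGraph G x y k).Adj (Sum.inl v) (Sum.inl u) →
      (subdividedGraph G x y k).Adj (Sum.inl v) (Sum.inr i) → c s(v, u) ≠ c s(x, y) := by
    intro v u i hu hi
    rw [subdividedGraph_adj_inl_inl] at hu
    rw [subdividedGraph_adj_inl_inr] at hi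
    obtain ⟨rfl, -⟩ | ⟨rfl, -⟩ := hi
    · exact hc _ _ _ hu.1 hxy (by tauto)
    · rw [Sym2.eq_swap (a := x)]
      exact hc _ _ _ hu.1 hxy.symm (by tauto)
  have hne := hxy.ne
  rintro (v | i) (u | j) (w | l) hu hw huw
  · rw [subdividedGraph_adj_inl_inl] at hu hw
    exact hc v u w hu.1 hw.1 (by simpa using huw)
  · exact old_ne_new v u l hu hw
  · exact (old_ne_new v w j hw hu).symm
  · rw [subdividedGraph_adj_inl_inr] at hu hw
    simp only [ne_eq, Sum.inr.injEq, Fin.ext_iff] at huw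
    grind
  · rw [subdividedGraph_adj_inr_inl] at hu hw
    grind
  · rw [subdividedGraph_adj_inr_inl] at hu
    rw [subdividedGraph_adj_inr_inr] at hw
    rw [subdividedColoring_inr_inl, subdividedColoring_inr_inr, if_pos (by omega)]
    exact hq
  · rw [subdividedGraph_adj_inr_inl] at hw
    rw [subdividedGraph_adj_inr_inr] at hu
    rw [subdividedColoring_inr_inl, subdividedColoring_inr_inr, if_pos (by omega)]
    exact hq.symm
  · rw [subdividedGraph_adj_inr_inr] at hu hw
    simp only [ne_eq, Sum.inr.injEq, Fin.ext_iff] at huw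
    rw [subdividedColoring_inr_inr, subdividedColoring_inr_inr]
    split_ifs
    · omega
    · exact hq.symm
    · exact hq
    · omega

theorem colorsAt_subdividedColoring_inl (hxy : G.Adj x y) (hk : 1 ≤ k) (v : V) :
    colorsAt (subdividedGraph G x y k) (subdividedColoring k c (c s(x, y)) q) (Sum.inl v) =
      colorsAt G c v := by
  ext n
  rw [mem_colorsAt_iff_adj, mem_colorsAt_iff_adj]
  constructor
  · rintro ⟨u | i, hu, rfl⟩
    · exact ⟨u, (subdividedGraph_adj_inl_inl.1 hu).1, rfl⟩
    · obtain ⟨rfl, -⟩ | ⟨rfl, -⟩ := subdividedGraph_adj_inl_inr.1 hu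
      · exact ⟨y, hxy, rfl⟩
      · exact ⟨x, hxy.symm, by rw [Sym2.eq_swap]; rfl⟩
  · rintro ⟨u, hu, rfl⟩
    by_cases h₁ : v = x ∧ u = y
    · obtain ⟨rfl, rfl⟩ := h₁
      exact ⟨Sum.inr ⟨0, by omega⟩, subdividedGraph_adj_inl_inr.2 (by simp), rfl⟩
    by_cases h₂ : v = y ∧ u = x
    · obtain ⟨rfl, rfl⟩ := h₂
      exact ⟨Sum.inr ⟨2 * k - 1, by omega⟩, subdividedGraph_adj_inl_inr.2 (by simp),
        by rw [Sym2.eq_swap (a := v)]; rfl⟩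
    exact ⟨Sum.inl u, subdividedGraph_adj_inl_inl.2 ⟨hu, h₁, h₂⟩, rfl⟩

theorem colorsAt_subdividedColoring_inr (p : ℕ) (i : Fin (2 * k)) :
    colorsAt (subdividedGraph G x y k) (subdividedColoring k c p q) (Sum.inr i) = {p, q} := by
  ext n
  rw [mem_colorsAt_iff_adj, Set.mem_insert_iff, Set.mem_singleton_iff]
  have hi := i.2
  constructor
  · rintro ⟨u | j, -, rfl⟩
    · exact Or.inl rfl
    · rw [subdividedColoring_inr_inr]
      split_ifs <;> simp
  · obtain h | h := Nat.mod_two_eq_zero_or_one i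
    · rintro (rfl | rfl)
      · by_cases h₀ : (i : ℕ) = 0
        · exact ⟨Sum.inl x, subdividedGraph_adj_inr_inl.2 (Or.inl ⟨rfl, h₀⟩), rfl⟩
        · refine ⟨Sum.inr ⟨i - 1, by omega⟩, subdividedGraph_adj_inr_inr.2 ?_, ?_⟩
          · simp only; omega
          · rw [subdividedColoring_inr_inr, if_neg (by simp only; omega)]
      · refine ⟨Sum.inr ⟨i + 1, by omega⟩, subdividedGraph_adj_inr_inr.2 (Or.inl rfl), ?_⟩
        rw [subdividedColoring_inr_inr, if_pos (by simp only; omega)]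
    · rintro (rfl | rfl)
      · by_cases h₀ : (i : ℕ) = 2 * k - 1
        · exact ⟨Sum.inl y, subdividedGraph_adj_inr_inl.2 (Or.inr ⟨rfl, h₀⟩), rfl⟩
        · refine ⟨Sum.inr ⟨i + 1, by omega⟩, subdividedGraph_adj_inr_inr.2 (Or.inl rfl), ?_⟩
          rw [subdividedColoring_inr_inr, if_neg (by simp only; omega)]
      · refine ⟨Sum.inr ⟨i - 1, by omega⟩, subdividedGraph_adj_inr_inr.2 ?_, ?_⟩
        · simp only; omega
        · rw [subdividedColoring_inr_inr, if_pos (by simp only; omega)]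

theorem subdividedColoring_ne {c c' : Sym2 V → ℕ} {p q : ℕ} (hpq : p ≠ q)
    (hc : ∀ e ∈ G.edgeSet, c e ≠ c' e) :
    ∀ e ∈ (subdividedGraph G x y k).edgeSet,
      subdividedColoring k c p q e ≠ subdividedColoring k c' q p e := by
  refine Sym2.ind ?_
  rintro (u | i) (v | j) h
  · exact hc s(u, v) (subdividedGraph_adj_inl_inl.1 h).1
  · exact hpq
  · exact hpq
  · rw [subdividedColoring_inr_inr, subdividedColoring_inr_inr]
    split_ifs
    · exact hpq.symm
    · exact hpq

end SubdividedGraph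

/-- If `G` is `2`-simultaneous edge colorable and `G'` is obtained from `G` by replacing an
edge `xy` with a path through `2k` new vertices, then `G'` is `2`-simultaneous edge
colorable. -/
theorem subdividedGraph_simultaneousEdgeColorable
    {V : Type*} (G : SimpleGraph V) (x y : V) (hxy : G.Adj x y) (k : ℕ) (hk : 1 ≤ k)
    (hG : SimultaneousEdgeColorable G 2) :
    SimultaneousEdgeColorable (subdividedGraph G x y k) 2 := by
  obtain ⟨c, hproper, hcolors, hne⟩ := hG
  have flip_ne : ∀ i : Fin 2, i ≠ 1 - i := by decide
  have eq_flip : ∀ i j : Fin 2, i ≠ j → 1 - i = j ∧ 1 - j = i := by decide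
  refine ⟨fun i => subdividedColoring k (c i) (c i s(x, y)) (c (1 - i) s(x, y)),
    fun i => ?_, fun i j v => ?_, fun i j hij => ?_⟩
  · exact isProperEdgeColoring_subdividedColoring hxy hk (hproper i)
      (hne i (1 - i) (flip_ne i) _ hxy)
  · obtain v | l := v
    · simp only [colorsAt_subdividedColoring_inl hxy hk]
      exact hcolors i j v
    · simp only [colorsAt_subdividedColoring_inr]
      by_cases hij : i = j
      · rw [hij]
      · rw [(eq_flip i j hij).1, (eq_flip i j hij).2, Set.pair_comm]
  · simp only [(eq_flip i j hij).1, (eq_flip i j hij).2]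
    exact subdividedColoring_ne (hne i j hij _ hxy) (hne i j hij)
end

section
/- Let k ≥ 2 and let G be a bridgeless graph whose girth is at least 2k − 1. If G is 2-simultaneous edge colorable, then |E(G)| ≥ k · χ'(G), where χ'(G) is the edge chromatic number of G. -/
open SimpleGraph

/-- The edge chromatic number of `G`: the least `l` such that `G` has a proper edge coloring
using colors from `{1, …, l}`. -/
noncomputable def edgeChromaticNumber {V : Type*} (G : SimpleGraph V) : ℕ :=
  sInf {l | ∃ c : Sym2 V → ℕ, IsProperEdgeColoring G c ∧ ∀ e ∈ G.edgeSet, c e ∈ Set.Icc 1 l}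

/-- A finite graph with an edge in which no vertex has exactly one neighbor contains a cycle. -/
theorem not_isAcyclic_of_exists_ne_adj {V : Type*} [Finite V] {H : SimpleGraph V} {a b : V}
    (hab : H.Adj a b) (h : ∀ ⦃u w⦄, H.Adj u w → ∃ x, x ≠ w ∧ H.Adj u x) : ¬ H.IsAcyclic := by
  intro hH
  have : Nonempty V := ⟨a⟩
  have : Fintype H.edgeSet := Fintype.ofFinite _
  obtain ⟨u, v, p, hp, hmax⟩ := Walk.exists_isPath_forall_isPath_length_le_length H
  have hnil : ¬ p.Nil := by
    intro hn
    have := hmax _ _ _ (Walk.IsPath.of_adj hab)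
    rw [Walk.length_eq_zero_iff.2 hn] at this
    simp at this
  obtain ⟨x, hx, hux⟩ := h (p.adj_snd hnil)
  by_cases hxp : x ∈ p.support
  · exact hx (hH.eq_snd_of_adj_start hp hux hxp)
  · have := hmax _ _ _ (hp.cons (h := hux.symm) hxp)
    simp at this

/-- A cycle whose vertices are all covered by the edges in `M` has length at most twice the
number of edges in `M`. -/
theorem length_le_two_mul_card_of_isCycle {V : Type*} {H : SimpleGraph V} {a : V}
    {p : H.Walk a a} (hp : p.IsCycle) {M : Finset (Sym2 V)}
    (hM : ∀ v ∈ p.support, ∃ e ∈ M, v ∈ e) : p.length ≤ 2 * M.card := by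
  classical
  have hlen : p.support.tail.toFinset.card = p.length := by
    rw [List.toFinset_card_of_nodup hp.support_nodup]
    simp
  rw [← hlen, mul_comm]
  calc p.support.tail.toFinset.card ≤ (M.biUnion Sym2.toFinset).card := by
        refine Finset.card_le_card fun v hv ↦ ?_
        obtain ⟨e, he, hve⟩ := hM v (List.mem_of_mem_tail (List.mem_toFinset.1 hv))
        exact Finset.mem_biUnion.2 ⟨e, he, Sym2.mem_toFinset.2 hve⟩
    _ ≤ M.card * 2 := Finset.card_biUnion_le_card_mul _ _ _ fun e _ ↦ by
        rw [Sym2.card_toFinset]; split_ifs <;> lia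

/-- Each color class of a `2`-simultaneous edge coloring of a graph of girth at least `2k - 1`
contains at least `k` edges. -/
theorem IsSimultaneousEdgeColoring.le_card_filter {V : Type*} [Finite V] {G : SimpleGraph V}
    [Fintype G.edgeSet] {c : Fin 2 → Sym2 V → ℕ} (hc : IsSimultaneousEdgeColoring G 2 c) {k : ℕ}
    (hgirth : ((2 * k - 1 : ℕ) : ℕ∞) ≤ G.egirth) {e : Sym2 V} (he : e ∈ G.edgeSet) :
    k ≤ (G.edgeFinset.filter fun e' ↦ c 0 e' = c 0 e).card := by
  classical
  obtain ⟨-, hsame, hne⟩ := hc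
  let H : SimpleGraph V :=
    { Adj := fun u v ↦ G.Adj u v ∧ ∃ i, c i s(u, v) = c 0 e
      symm := ⟨fun u v h ↦ ⟨h.1.symm, by simpa only [Sym2.eq_swap] using h.2⟩⟩
      loopless := ⟨fun u h ↦ h.1.ne rfl⟩ }
  have hHG : H ≤ G := fun u v h ↦ h.1
  have hcover : ∀ {u w}, H.Adj u w → ∀ i, ∃ x, G.Adj u x ∧ c i s(u, x) = c 0 e := by
    rintro u w ⟨huw, j, hj⟩ i
    have hmem : c 0 e ∈ colorsAt G (c j) u := ⟨s(u, w), huw, Sym2.mem_mk_left u w, hj⟩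
    rw [hsame j i] at hmem
    obtain ⟨f, hf, huf, hfc⟩ := hmem
    obtain ⟨x, rfl⟩ := huf
    exact ⟨x, hf, hfc⟩
  have hcyc : ¬ H.IsAcyclic := by
    induction e with | _ a b
    refine not_isAcyclic_of_exists_ne_adj (a := a) (b := b) ⟨he, 0, rfl⟩ fun u w huw ↦ ?_
    obtain ⟨-, j, hj⟩ := id huw
    obtain ⟨i, hij⟩ := exists_ne j
    obtain ⟨x, hux, hx⟩ := hcover huw i
    refine ⟨x, ?_, hux, i, hx⟩
    rintro rfl
    exact hne i j hij _ hux (hx.trans hj.symm)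
  simp only [IsAcyclic, not_forall, not_not] at hcyc
  obtain ⟨a, p, hp⟩ := hcyc
  have hlong : 2 * k - 1 ≤ p.length := by
    have := (hgirth.trans (egirth_anti hHG)).trans (egirth_le_length hp)
    exact_mod_cast this
  have hshort := length_le_two_mul_card_of_isCycle hp
    (M := G.edgeFinset.filter fun e' ↦ c 0 e' = c 0 e) fun v hv ↦ by
      obtain ⟨w, -, hvw⟩ := adj_of_mem_walk_support p hp.not_nil hv
      obtain ⟨x, hvx, hx⟩ := hcover hvw 0
      exact ⟨s(v, x), by simpa using ⟨hvx, hx⟩, Sym2.mem_mk_left v x⟩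
  lia

/-- The edge chromatic number is at most the number of colors used by a proper edge coloring. -/
theorem IsProperEdgeColoring.edgeChromaticNumber_le {V : Type*} {G : SimpleGraph V}
    [Fintype G.edgeSet] {c : Sym2 V → ℕ} (hc : IsProperEdgeColoring G c) :
    edgeChromaticNumber G ≤ (G.edgeFinset.image c).card := by
  classical
  set S := G.edgeFinset.image c
  have hS : ∀ {e}, e ∈ G.edgeSet → c e ∈ S := fun he ↦
    Finset.mem_image_of_mem c (mem_edgeFinset.2 he)
  refine Nat.sInf_le ⟨fun e ↦ if h : c e ∈ S then S.equivFin ⟨c e, h⟩ + 1 else 0, ?_, ?_⟩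
  · intro e₁ h₁ e₂ h₂ hne hv heq
    refine hc e₁ h₁ e₂ h₂ hne hv ?_
    simpa [hS h₁, hS h₂, Fin.val_inj] using heq
  · intro e he
    simp only [hS he, dite_true, Set.mem_Icc]
    lia

/-- Let `k ≥ 2` and let `G` be a bridgeless graph of girth at least `2k - 1`. If `G` is
`2`-simultaneous edge colorable, then `|E(G)| ≥ k · χ'(G)`. -/
theorem card_edges_ge_of_simultaneousEdgeColorable
    {V : Type*} [Fintype V] (G : SimpleGraph V) (k : ℕ) (hk : 2 ≤ k)
    (hbridgeless : IsKEdgeConnected G 2)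
    (hgirth : ((2 * k - 1 : ℕ) : ℕ∞) ≤ G.egirth)
    (hSE : SimultaneousEdgeColorable G 2) :
    k * edgeChromaticNumber G ≤ G.edgeSet.ncard := by
  classical
  obtain ⟨c, hc⟩ := hSE
  rw [← coe_edgeFinset, Set.ncard_coe_finset]
  calc k * edgeChromaticNumber G ≤ k * (G.edgeFinset.image (c 0)).card :=
        Nat.mul_le_mul_left k (hc.1 0).edgeChromaticNumber_le
    _ ≤ G.edgeFinset.card := by
        refine Finset.mul_card_image_le_card _ k fun a ha ↦ ?_
        obtain ⟨e, he, rfl⟩ := Finset.mem_image.1 ha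
        exact hc.le_card_filter hgirth (mem_edgeFinset.1 he)
end

section
/- Let G be a graph with a Hamiltonian circuit C of even length such that the graph G ∖ E(C) (obtained by deleting the edges of C) is bipartite. If G ∖ E(C) has an oriented cycle double cover, then G is 2-simultaneous edge colorable. -/
open SimpleGraph

/-- `H` has an oriented cycle double cover: a family of (not necessarily distinct) directed
circuits such that every edge of `H` is covered exactly twice, once in each direction; i.e.
for every ordered pair of adjacent vertices `a, b`, exactly one circuit of the family
traverses the edge `ab` in the direction from `a` to `b`. -/
def HasOCDC {V : Type*} (H : SimpleGraph V) : Prop :=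
  ∃ (t : ℕ) (v : Fin t → V) (w : ∀ i, H.Walk (v i) (v i)),
    (∀ i, (w i).IsCycle) ∧
    ∀ (a b : V) (hab : H.Adj a b),
      ∃! i : Fin t, (⟨(a, b), hab⟩ : H.Dart) ∈ (w i).darts

namespace SimpleGraph.Walk

variable {V : Type*} {G : SimpleGraph V} {u x : V} {w : G.Walk u u}

lemma IsCycle.eq_of_mem_darts_of_snd_eq (hw : w.IsCycle) {d d' : G.Dart}
    (hd : d ∈ w.darts) (hd' : d' ∈ w.darts) (h : d.snd = d'.snd) : d = d' := by
  have hnodup := hw.support_nodup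
  rw [← map_snd_darts] at hnodup
  exact List.inj_on_of_nodup_map hnodup hd hd' h

lemma IsCycle.eq_of_mem_darts_of_fst_eq (hw : w.IsCycle) {d d' : G.Dart}
    (hd : d ∈ w.darts) (hd' : d' ∈ w.darts) (h : d.fst = d'.fst) : d = d' :=
  Dart.symm_involutive.injective <|
    hw.reverse.eq_of_mem_darts_of_snd_eq (by simpa using hd) (by simpa using hd') h

lemma IsCycle.symm_notMem_darts (hw : w.IsCycle) {d : G.Dart} (hd : d ∈ w.darts) :
    d.symm ∉ w.darts := fun hd' ↦
  d.symm_ne <| List.inj_on_of_nodup_map hw.edges_nodup hd' hd d.edge_symm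

lemma IsCycle.exists_mem_darts_snd_eq (hw : w.IsCycle) (hx : x ∈ w.support) :
    ∃ d ∈ w.darts, d.snd = x := by
  have hx' : x ∈ w.support.tail := by
    rw [← cons_tail_support, List.mem_cons] at hx
    rcases hx with rfl | hx
    · exact end_mem_tail_support hw.not_nil
    · exact hx
  rwa [← map_snd_darts, List.mem_map] at hx'

lemma IsCycle.exists_mem_darts_fst_eq (hw : w.IsCycle) (hx : x ∈ w.support) :
    ∃ d ∈ w.darts, d.fst = x := by
  obtain ⟨d, hd, rfl⟩ := hw.reverse.exists_mem_darts_snd_eq (x := x) (by simpa using hx)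
  exact ⟨d.symm, by simpa using hd, rfl⟩

/-- A graph whose edges all lie on a single even cycle is `2`-colorable. -/
lemma IsCycle.colorable_two_of_even (hw : w.IsCycle) (heven : Even w.length)
    (hcov : ∀ e ∈ G.edgeSet, e ∈ w.edges) : G.Colorable 2 := by
  classical
  have hlen := hw.three_le_length
  have hidx {i : ℕ} (hi : i < w.length) : w.support.idxOf (w.getVert i) = i := by
    have hmem := w.getVert_mem_support i
    have hle : w.support.idxOf (w.getVert i) ≤ i := by
      by_contra! hlt
      have := List.not_of_lt_findIdx hlt
      simp [support_getElem_eq_getVert] at this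
    exact hw.getVert_injOn' (by simp; omega) (by simp; omega) (w.getVert_support_idxOf hmem)
  have hdart {d : G.Dart} (hd : d ∈ w.darts) :
      w.support.idxOf d.fst % 2 ≠ w.support.idxOf d.snd % 2 := by
    obtain ⟨i, hi, rfl⟩ := List.getElem_of_mem hd
    rw [darts_getElem_eq_getVert]
    rw [length_darts] at hi
    change w.support.idxOf (w.getVert i) % 2 ≠ w.support.idxOf (w.getVert (i + 1)) % 2
    rw [hidx hi]
    rcases Nat.lt_or_ge (i + 1) w.length with h | h
    · rw [hidx h]
      omega
    · have h0 : w.getVert (i + 1) = w.getVert 0 := by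
        rw [getVert_of_length_le _ h, getVert_zero]
      rw [h0, hidx (by omega)]
      obtain ⟨m, hm⟩ := heven
      omega
  refine ⟨Coloring.mk (fun y ↦ ⟨w.support.idxOf y % 2, Nat.mod_lt _ two_pos⟩) ?_⟩
  intro a b hab
  obtain ⟨d, hd, hde⟩ := List.mem_map.1 (hcov s(a, b) hab)
  rw [Ne, Fin.mk.injEq]
  rcases dart_edge_eq_mk'_iff'.1 hde with ⟨rfl, rfl⟩ | ⟨rfl, rfl⟩
  · exact hdart hd
  · exact (hdart hd).symm

/-- A cycle covering every edge, together with its reverse, is an oriented cycle double cover. -/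
lemma IsCycle.hasOCDC (hw : w.IsCycle) (hcov : ∀ e ∈ G.edgeSet, e ∈ w.edges) : HasOCDC G := by
  refine ⟨2, fun _ ↦ u, fun i ↦ if i = 0 then w else w.reverse, fun i ↦ ?_, fun a b hab ↦ ?_⟩
  · dsimp only
    split_ifs
    exacts [hw, hw.reverse]
  have key : (⟨(a, b), hab⟩ : G.Dart) ∈ w.darts ↔ (⟨(a, b), hab⟩ : G.Dart) ∉ w.reverse.darts := by
    rw [mem_darts_reverse]
    refine ⟨hw.symm_notMem_darts, fun h ↦ ?_⟩
    obtain ⟨d, hd, hde⟩ := List.mem_map.1 (hcov s(a, b) hab)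
    rcases (dart_edge_eq_iff d ⟨(a, b), hab⟩).1 hde with rfl | rfl
    · exact hd
    · exact absurd hd h
  by_cases h : (⟨(a, b), hab⟩ : G.Dart) ∈ w.darts
  · refine ⟨0, h, fun j hj ↦ ?_⟩
    by_contra hne
    exact key.1 h (by simpa [hne] using hj)
  · refine ⟨1, not_not.1 fun h' ↦ h (key.2 h'), fun j hj ↦ ?_⟩
    by_contra hne
    have h0 : j = 0 := by omega
    exact h (by simpa [h0] using hj)

end SimpleGraph.Walk

/-- A bipartite graph with an oriented cycle double cover is `2`-simultaneous edge colorable: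
an edge gets, in the two colorings, the names of the two circuits traversing it, chosen
according to the side of the bipartition from which the edge is left. -/
theorem SimultaneousEdgeColorable.of_hasOCDC {V : Type*} {H : SimpleGraph V}
    (hbip : H.Colorable 2) (hocdc : HasOCDC H) : SimultaneousEdgeColorable H 2 := by
  classical
  obtain ⟨col⟩ := hbip
  obtain ⟨t, v, w, hw, hcov⟩ := hocdc
  choose I hI hU using hcov
  have hother {a b : V} (hab : H.Adj a b) {k : Fin 2} : col a = k ↔ col b ≠ k := by
    have := col.valid hab
    omega
  obtain ⟨c, hc⟩ : ∃ c : Fin 2 → Sym2 V → ℕ, ∀ k a b (hab : H.Adj a b), col a = k →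
      c k s(a, b) = I a b hab := by
    refine ⟨fun k e ↦ if h : ∃ a b, ∃ _ : H.Adj a b, e = s(a, b) ∧ col a = k then
      I _ _ h.choose_spec.choose_spec.choose else 0, fun k a b hab ha ↦ ?_⟩
    have h : ∃ a' b', ∃ _ : H.Adj a' b', s(a, b) = s(a', b') ∧ col a' = k :=
      ⟨a, b, hab, rfl, ha⟩
    have hspec := h.choose_spec.choose_spec.choose_spec
    refine (dif_pos h).trans ?_
    rcases Sym2.eq_iff.1 hspec.1 with ⟨h1, h2⟩ | ⟨h1, h2⟩
    · congr 2
      exacts [h1.symm, h2.symm]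
    · exact absurd (h2 ▸ hspec.2) ((hother hab).1 ha)
  have horient (k : Fin 2) {e : Sym2 V} (he : e ∈ H.edgeSet) :
      ∃ a b, ∃ _ : H.Adj a b, e = s(a, b) ∧ col a = k := by
    induction e with | _ a b
    by_cases ha : col a = k
    · exact ⟨a, b, he, rfl, ha⟩
    · exact ⟨b, a, he.symm, Sym2.eq_swap, (hother he.symm).2 ha⟩
  have hcolors (k : Fin 2) (x : V) :
      colorsAt H (c k) x = {n | ∃ i : Fin t, x ∈ (w i).support ∧ (i : ℕ) = n} := by
    ext n
    constructor
    · rintro ⟨e, he, hx, rfl⟩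
      obtain ⟨a, b, hab, rfl, ha⟩ := horient k he
      refine ⟨I a b hab, ?_, (hc k a b hab ha).symm⟩
      rcases Sym2.mem_iff.1 hx with rfl | rfl
      · exact (w _).dart_fst_mem_support_of_mem_darts (hI _ _ hab)
      · exact (w _).dart_snd_mem_support_of_mem_darts (hI _ _ hab)
    · rintro ⟨i, hx, rfl⟩
      obtain ⟨d, hd, hxd, hk⟩ : ∃ d ∈ (w i).darts, x ∈ d.edge ∧ col d.fst = k := by
        by_cases hk : col x = k
        · obtain ⟨d, hd, rfl⟩ := (hw i).exists_mem_darts_fst_eq hx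
          exact ⟨d, hd, Sym2.mem_mk_left _ _, hk⟩
        · obtain ⟨d, hd, rfl⟩ := (hw i).exists_mem_darts_snd_eq hx
          exact ⟨d, hd, Sym2.mem_mk_right _ _, (hother d.adj).2 hk⟩
      refine ⟨d.edge, d.edge_mem, hxd, ?_⟩
      have hi : i = I _ _ d.adj := hU _ _ d.adj i hd
      rw [hi]
      exact hc k _ _ d.adj hk
  refine ⟨c, fun k e₁ he₁ e₂ he₂ hne ↦ ?_, fun i j x ↦ (hcolors i x).trans (hcolors j x).symm,
    fun i j hij e he heq ↦ ?_⟩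
  · rintro ⟨x, hx₁, hx₂⟩ heq
    obtain ⟨a, b, hab, rfl, ha⟩ := horient k he₁
    obtain ⟨a', b', hab', rfl, ha'⟩ := horient k he₂
    rw [hc k a b hab ha, hc k a' b' hab' ha', Fin.val_inj] at heq
    have hd := hI a b hab
    have hd' := hI a' b' hab'
    rw [heq] at hd
    have hb := (hother hab).1 ha
    have hb' := (hother hab').1 ha'
    refine hne (congrArg Dart.edge (?_ : (⟨(a, b), hab⟩ : H.Dart) = ⟨(a', b'), hab'⟩))
    rcases Sym2.mem_iff.1 hx₁ with rfl | rfl <;> rcases Sym2.mem_iff.1 hx₂ with rfl | rfl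
    · exact (hw _).eq_of_mem_darts_of_fst_eq hd hd' rfl
    · exact absurd ha hb'
    · exact absurd ha' hb
    · exact (hw _).eq_of_mem_darts_of_snd_eq hd hd' rfl
  · obtain ⟨a, b, hab, rfl, ha⟩ := horient i he
    have hb : col b = j := (hother hab.symm).2 fun h ↦ hij (ha.symm.trans h)
    rw [hc i a b hab ha, Sym2.eq_swap, hc j b a hab.symm hb, Fin.val_inj] at heq
    have hd := hI a b hab
    rw [heq] at hd
    exact (hw _).symm_notMem_darts hd (hI b a hab.symm)

/-- Simultaneous edge colorability passes to edge-disjoint unions. -/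
theorem SimultaneousEdgeColorable.sup {V : Type*} {G H : SimpleGraph V} {μ : ℕ}
    (hG : SimultaneousEdgeColorable G μ) (hH : SimultaneousEdgeColorable H μ)
    (hdisj : Disjoint G H) : SimultaneousEdgeColorable (G ⊔ H) μ := by
  classical
  obtain ⟨c, hc, hcs, hcd⟩ := hG
  obtain ⟨d, hd, hds, hdd⟩ := hH
  have hnot {e : Sym2 V} (he : e ∈ H.edgeSet) : e ∉ G.edgeSet :=
    fun he' ↦ Set.disjoint_left.1 (disjoint_edgeSet.2 hdisj) he' he
  -- Colors of `G` become even and colors of `H` become odd.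
  set f : Fin μ → Sym2 V → ℕ := fun i e ↦ if e ∈ G.edgeSet then 2 * c i e else 2 * d i e + 1
  have hfG (i) {e : Sym2 V} (he : e ∈ G.edgeSet) : f i e = 2 * c i e := if_pos he
  have hfH (i) {e : Sym2 V} (he : e ∈ H.edgeSet) : f i e = 2 * d i e + 1 := if_neg (hnot he)
  have hcolors (i : Fin μ) (x : V) : colorsAt (G ⊔ H) (f i) x =
      (fun n ↦ 2 * n) '' colorsAt G (c i) x ∪ (fun n ↦ 2 * n + 1) '' colorsAt H (d i) x := by
    ext n
    constructor
    · rintro ⟨e, he, hx, rfl⟩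
      rw [edgeSet_sup] at he
      rcases he with he | he
      · exact Or.inl ⟨_, ⟨e, he, hx, rfl⟩, (hfG i he).symm⟩
      · exact Or.inr ⟨_, ⟨e, he, hx, rfl⟩, (hfH i he).symm⟩
    · rintro (⟨_, ⟨e, he, hx, rfl⟩, rfl⟩ | ⟨_, ⟨e, he, hx, rfl⟩, rfl⟩)
      · exact ⟨e, by rw [edgeSet_sup]; exact Or.inl he, hx, hfG i he⟩
      · exact ⟨e, by rw [edgeSet_sup]; exact Or.inr he, hx, hfH i he⟩
  refine ⟨f, fun i e₁ he₁ e₂ he₂ hne hx ↦ ?_, fun i j x ↦ ?_, fun i j hij e he ↦ ?_⟩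
  · rw [edgeSet_sup] at he₁ he₂
    rcases he₁ with he₁ | he₁ <;> rcases he₂ with he₂ | he₂
    · have := hc i e₁ he₁ e₂ he₂ hne hx
      rw [hfG i he₁, hfG i he₂]
      omega
    · rw [hfG i he₁, hfH i he₂]
      omega
    · rw [hfH i he₁, hfG i he₂]
      omega
    · have := hd i e₁ he₁ e₂ he₂ hne hx
      rw [hfH i he₁, hfH i he₂]
      omega
  · rw [hcolors, hcolors, hcs i j, hds i j]
  · rw [edgeSet_sup] at he
    rcases he with he | he
    · have := hcd i j hij e he
      rw [hfG i he, hfG j he]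
      omega
    · have := hdd i j hij e he
      rw [hfH i he, hfH j he]
      omega

/-- If `G` has an even Hamiltonian circuit `C` such that `G \ E(C)` is bipartite and has an
oriented cycle double cover, then `G` is `2`-simultaneous edge colorable. -/
theorem simultaneousEdgeColorable_of_hamiltonian_ocdc
    {V : Type*} [Fintype V] [DecidableEq V] (G : SimpleGraph V) (v : V) (C : G.Walk v v)
    (hham : C.IsHamiltonianCycle) (heven : Even C.length)
    (hbip : (G.deleteEdges {e | e ∈ C.edges}).Colorable 2)
    (hocdc : HasOCDC (G.deleteEdges {e | e ∈ C.edges})) :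
    SimultaneousEdgeColorable G 2 := by
  set S : Set (Sym2 V) := {e | e ∈ C.edges}
  have hSG : S ⊆ G.edgeSet := fun e he ↦ C.edges_subset_edgeSet he
  have hedge : (fromEdgeSet S).edgeSet = S := by
    rw [edgeSet_fromEdgeSet, sdiff_eq_left, Set.disjoint_left]
    exact fun e he ↦ G.not_isDiag_of_mem_edgeSet (hSG he)
  have hmem : ∀ e ∈ C.edges, e ∈ (fromEdgeSet S).edgeSet := fun e he ↦ hedge.ge he
  have hcyc := hham.isCycle.transfer hmem
  have hcov : ∀ e ∈ (fromEdgeSet S).edgeSet, e ∈ (C.transfer _ hmem).edges := fun e he ↦ by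
    rw [Walk.edges_transfer]
    exact hedge.le he
  have hC : SimultaneousEdgeColorable (fromEdgeSet S) 2 :=
    .of_hasOCDC (hcyc.colorable_two_of_even (by rwa [Walk.length_transfer]) hcov)
      (hcyc.hasOCDC hcov)
  have hsup : G.deleteEdges S ⊔ fromEdgeSet S = G := by
    rw [← edgeSet_inj, edgeSet_sup, hedge, edgeSet_deleteEdges, Set.sdiff_union_of_subset hSG]
  have hdisj : Disjoint (G.deleteEdges S) (fromEdgeSet S) := by
    rw [← disjoint_edgeSet, hedge, edgeSet_deleteEdges]
    exact Set.disjoint_sdiff_left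
  exact hsup ▸ (SimultaneousEdgeColorable.of_hasOCDC hbip hocdc).sup hC hdisj
end
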